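/- arXiv:0904.1325 — 2 statements merged into one kernel-verified Lean document; each statement's English description precedes it below -/
import Mathlib

section
/- For d = 7, the Poincaré series of the algebra of covariants of the binary 7-form satisfies P_7(z) = p_7(z)/((1 − z)(1 − z²)(1 − z⁴)(1 − z⁶)(1 − z⁸)(1 − z^{10})(1 − z^{12})), where p_7(z) = z^{35} + 2z^{33} + 6z^{32} + 10z^{31} + 19z^{30} + 28z^{29} + 44z^{28} + 61z^{27} + 79z^{26} + 102z^{25} + 129z^{24} + 156z^{23} + 173z^{22} + 196z^{21} + 215z^{20} + 230z^{19} + 231z^{18} + 231z^{17} + 230z^{16} + 215z^{15} + 196z^{14} + 173z^{13} + 156z^{12} + 129z^{11} + 102z^{10} + 79z^9 + 61z^8 + 44z^7 + 28z^6 + 19z^5 + 10z^4 + 6z^3 + 2z^2 + 1; i.e. ∑_{n≥0} dim(S_n) z^n = p_7(z) · ((1 − z)(1 − z²)(1 − z⁴)(1 − z⁶)(1 − z⁸)(1 − z^{10})(1 − z^{12}))^{−1} in ℂ[[z]]. -/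
noncomputable section

/-- The derivation D₁ on ℂ[x_0,…,x_d] with D₁(x_0)=0 and D₁(x_i)=i·x_{i-1}
(for i = 0 the coefficient i vanishes, so the wrap-around in `Fin` is harmless). -/
def D1 (d : ℕ) :
    Derivation ℂ (MvPolynomial (Fin (d + 1)) ℂ) (MvPolynomial (Fin (d + 1)) ℂ) :=
  MvPolynomial.mkDerivation ℂ (fun i => (i.val : ℂ) • MvPolynomial.X (i - 1))

/-- S_n: the space of homogeneous degree-n seminvariants of the binary d-form. -/
def Sn (d n : ℕ) : Submodule ℂ (MvPolynomial (Fin (d + 1)) ℂ) :=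
  MvPolynomial.homogeneousSubmodule (Fin (d + 1)) ℂ n ⊓ LinearMap.ker (D1 d).toLinearMap

/-- The Poincaré series P_d(z) = ∑_{n≥0} dim(S_n) zⁿ of the algebra of covariants. -/
def PSeries (d : ℕ) : PowerSeries ℂ :=
  PowerSeries.mk fun n => (Module.finrank ℂ (Sn d n) : ℂ)

/-- An `sl₂`-type positivity argument: if `e` raises the weight by `2`, `f` lowers it by `2`,
`[e, f]` acts on weight vectors by their weight and the weights are bounded above, then `e ∘ f`
has no nonpositive eigenvalue on a space of positive weight. -/
theorem eq_zero_of_comp_eq_nonpos_smul {V : Type*} [AddCommGroup V] [Module ℂ V]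
    (e f : V →ₗ[ℂ] V) (A : ℤ → Submodule ℂ V) (N : ℤ)
    (he : ∀ m, ∀ v ∈ A m, e v ∈ A (m + 2)) (hN : ∀ m, N < m → A m = ⊥)
    (hef : ∀ m, ∀ v ∈ A m, e (f v) - f (e v) = (m : ℂ) • v)
    (m : ℤ) (hm : 0 < m) (l : ℤ) (hl : l ≤ 0) (v : V) (hv : v ∈ A m)
    (h : e (f v) = (l : ℂ) • v) : v = 0 := by
  induction hk : (N + 1 - m).toNat using Nat.strong_induction_on generalizing m l v with
  | _ k ih =>
    by_cases hmN : N < m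
    · simpa [hN m hmN] using hv
    have hfe : f (e v) = ((l - m : ℤ) : ℂ) • v := by
      have := hef m v hv
      rw [h] at this
      push_cast
      rw [sub_smul, ← this, sub_sub_cancel]
    have hev : e v = 0 := by
      refine ih _ ?_ (m + 2) (by omega) (l - m) (by omega) (e v) (he m v hv) ?_ rfl
      · omega
      · rw [hfe, map_smul]
    rw [hev, map_zero] at hfe
    refine (smul_eq_zero.mp hfe.symm).resolve_left ?_
    exact_mod_cast (by omega : l - m ≠ 0)

open MvPolynomial Finsupp

theorem MvPolynomial.IsWeightedHomogeneous.mkDerivation {R σ M : Type*} [CommSemiring R]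
    [AddCommMonoid M] {w : σ → M} {g : σ → MvPolynomial σ R} {c m : M}
    (hg : ∀ i, (g i).IsWeightedHomogeneous w (w i + c)) {p : MvPolynomial σ R}
    (hp : p.IsWeightedHomogeneous w m) :
    (MvPolynomial.mkDerivation R g p).IsWeightedHomogeneous w (m + c) := by
  classical
  rw [p.as_sum, map_sum]
  refine Submodule.sum_mem (weightedHomogeneousSubmodule R w (m + c)) fun a ha => ?_
  rw [mkDerivation_monomial]
  refine Submodule.smul_mem _ _ (Submodule.sum_mem _ fun i hi => ?_)
  have hm : m + c = weight w (a - single i 1) + (w i + c) := by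
    rw [← add_assoc, weight_sub_single_add (Finsupp.mem_support_iff.mp hi),
      hp (MvPolynomial.mem_support_iff.mp ha)]
  rw [hm]
  exact (isWeightedHomogeneous_monomial w _ _ rfl).mul (hg i)

theorem MvPolynomial.mkDerivation_eq_smul_of_isWeightedHomogeneous {R σ : Type*} [CommSemiring R]
    (r : σ → R) {m : R} {p : MvPolynomial σ R} (hp : p.IsWeightedHomogeneous r m) :
    MvPolynomial.mkDerivation R (fun i => r i • X i) p = m • p := by
  classical
  conv_rhs => rw [p.as_sum]
  conv_lhs => rw [p.as_sum]
  rw [map_sum, Finset.smul_sum]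
  refine Finset.sum_congr rfl fun a ha => ?_
  rw [mkDerivation_monomial, ← hp (MvPolynomial.mem_support_iff.mp ha), weight_apply]
  simp only [Finsupp.sum, Finset.smul_sum, Finset.sum_smul]
  refine Finset.sum_congr rfl fun i hi => ?_
  have hX : (X i : MvPolynomial σ R) = monomial (single i 1) 1 := rfl
  rw [hX, smul_eq_mul, mul_smul_comm, monomial_mul,
    Finsupp.sub_single_one_add (Finsupp.mem_support_iff.mp hi), add_tsub_cancel_right,
    smul_monomial, smul_monomial,
    smul_monomial]
  congr 1
  rw [nsmul_eq_mul]
  ring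

theorem MvPolynomial.weightedHomogeneousComponent_map {R σ M : Type*} [CommSemiring R]
    [AddCancelCommMonoid M] {w : σ → M} {c : M} (L : MvPolynomial σ R →ₗ[R] MvPolynomial σ R)
    (hL : ∀ m p, IsWeightedHomogeneous w p m → IsWeightedHomogeneous w (L p) (m + c))
    (m : M) (p : MvPolynomial σ R) :
    weightedHomogeneousComponent w (m + c) (L p) = L (weightedHomogeneousComponent w m p) := by
  classical
  induction p using MvPolynomial.induction_on' with
  | monomial a r =>
    have ha := isWeightedHomogeneous_monomial w a r rfl
    rw [weightedHomogeneousComponent_of_mem (hL _ _ ha), weightedHomogeneousComponent_of_mem ha]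
    simp only [add_left_inj]
    split_ifs <;> simp
  | add p q hp hq => simp only [map_add, hp, hq]

/-- The bidegree (degree, weight) of the variables: `x_i` has degree `1` and weight `d - 2i`. -/
def bidegree (d : ℕ) (i : Fin (d + 1)) : ℕ × ℤ := (1, d - 2 * i.val)

theorem weight_bidegree (d : ℕ) (a : Fin (d + 1) →₀ ℕ) :
    weight (bidegree d) a = (∑ i, a i, ∑ i, ((d : ℤ) - 2 * i.val) * a i) := by
  rw [weight_eq_sum]
  ext
  · simp [Prod.fst_sum, bidegree]
  · simp [Prod.snd_sum, bidegree, mul_comm]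

theorem abs_weight_bidegree_snd_le (d : ℕ) (a : Fin (d + 1) →₀ ℕ) :
    |(weight (bidegree d) a).2| ≤ d * (weight (bidegree d) a).1 := by
  rw [weight_bidegree]
  push_cast
  rw [Finset.mul_sum]
  refine (Finset.abs_sum_le_sum_abs _ _).trans (Finset.sum_le_sum fun i _ => ?_)
  rw [abs_mul, Nat.abs_cast]
  refine mul_le_mul_of_nonneg_right (abs_le.mpr ?_) (Int.natCast_nonneg _)
  omega

/-- The bihomogeneous polynomials of degree `n` and weight `m`. -/
abbrev weightSpace (d n : ℕ) (m : ℤ) : Submodule ℂ (MvPolynomial (Fin (d + 1)) ℂ) :=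
  weightedHomogeneousSubmodule ℂ (bidegree d) (n, m)

theorem weightSpace_eq_bot (d n : ℕ) (m : ℤ) (hm : (d * n : ℤ) < |m|) :
    weightSpace d n m = ⊥ := by
  refine (Submodule.eq_bot_iff _).mpr fun p hp => MvPolynomial.ext _ _ fun a => ?_
  by_contra ha
  have := abs_weight_bidegree_snd_le d a
  rw [hp ha] at this
  exact absurd this (not_le.mpr hm)

/-- The derivation opposite to `D1 d`, sending `x_i` to `(d - i) x_{i+1}`. -/
def D2 (d : ℕ) :
    Derivation ℂ (MvPolynomial (Fin (d + 1)) ℂ) (MvPolynomial (Fin (d + 1)) ℂ) :=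
  mkDerivation ℂ (fun i => ((d : ℂ) - i.val) • X (i + 1))

theorem isWeightedHomogeneous_D1 (d : ℕ) {m : ℕ × ℤ} {p : MvPolynomial (Fin (d + 1)) ℂ}
    (hp : p.IsWeightedHomogeneous (bidegree d) m) :
    (D1 d p).IsWeightedHomogeneous (bidegree d) (m + (0, 2)) := by
  refine hp.mkDerivation fun i => ?_
  rcases eq_or_ne i 0 with rfl | hi
  · simpa using isWeightedHomogeneous_zero ℂ _ _
  have h : bidegree d i + (0, 2) = bidegree d (i - 1) := by
    have h1 : i.val ≠ 0 := Fin.val_ne_zero_iff.mpr hi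
    have h2 : (i - 1).val = i.val - 1 := Fin.val_sub_one_of_ne_zero hi
    simp only [bidegree, h2, Prod.mk_add_mk, Prod.mk.injEq, add_zero, true_and]
    omega
  rw [h]
  exact Submodule.smul_mem (weightedHomogeneousSubmodule ℂ _ _) _ (isWeightedHomogeneous_X _ _ _)

theorem isWeightedHomogeneous_D2 (d : ℕ) {m : ℕ × ℤ} {p : MvPolynomial (Fin (d + 1)) ℂ}
    (hp : p.IsWeightedHomogeneous (bidegree d) m) :
    (D2 d p).IsWeightedHomogeneous (bidegree d) (m + (0, -2)) := by
  refine hp.mkDerivation fun i => ?_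
  rcases eq_or_ne i (Fin.last d) with rfl | hi
  · simpa using isWeightedHomogeneous_zero ℂ _ _
  have h : bidegree d i + (0, -2) = bidegree d (i + 1) := by
    have h2 : (i + 1).val = i.val + 1 := Fin.val_add_one_of_lt (Fin.lt_last_iff_ne_last.mpr hi)
    simp only [bidegree, h2, Prod.mk_add_mk, Prod.mk.injEq, add_zero, true_and]
    omega
  rw [h]
  exact Submodule.smul_mem (weightedHomogeneousSubmodule ℂ _ _) _ (isWeightedHomogeneous_X _ _ _)

theorem lie_D1_D2 (d : ℕ) :
    ⁅D1 d, D2 d⁆ = mkDerivation ℂ fun i => ((d : ℂ) - 2 * i.val) • X i := by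
  refine derivation_ext fun i => ?_
  rw [Derivation.commutator_apply]
  have h1 : D1 d (D2 d (X i)) = (((d : ℂ) - i.val) * (i.val + 1)) • X i := by
    simp only [D1, D2, mkDerivation_X, Derivation.map_smul, smul_smul, add_sub_cancel_right]
    rcases eq_or_ne i (Fin.last d) with rfl | hi
    · simp
    · rw [Fin.val_add_one_of_lt (Fin.lt_last_iff_ne_last.mpr hi)]
      push_cast
      rfl
  have h2 : D2 d (D1 d (X i)) = ((i.val : ℂ) * (d - i.val + 1)) • X i := by
    simp only [D1, D2, mkDerivation_X, Derivation.map_smul, smul_smul, sub_add_cancel]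
    rcases eq_or_ne i 0 with rfl | hi
    · simp
    · have h1 : 1 ≤ i.val := Nat.pos_of_ne_zero (Fin.val_ne_zero_iff.mpr hi)
      rw [Fin.val_sub_one_of_ne_zero hi]
      push_cast [h1]
      congr 1
      ring
  rw [h1, h2, mkDerivation_X, ← sub_smul]
  congr 1
  ring

theorem D1_D2_sub_D2_D1 (d n : ℕ) (m : ℤ) (p : MvPolynomial (Fin (d + 1)) ℂ)
    (hp : p ∈ weightSpace d n m) : D1 d (D2 d p) - D2 d (D1 d p) = (m : ℂ) • p := by
  rw [← Derivation.commutator_apply, lie_D1_D2]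
  refine mkDerivation_eq_smul_of_isWeightedHomogeneous _ fun a ha => ?_
  have h : (m : ℂ) = ((weight (bidegree d) a).2 : ℂ) := by rw [hp ha]
  rw [h, weight_bidegree, weight_eq_sum]
  push_cast
  exact Finset.sum_congr rfl fun i _ => by rw [nsmul_eq_mul, mul_comm]

theorem eq_zero_of_D1_eq_zero_of_neg (d n : ℕ) (m : ℤ) (hm : m < 0)
    (p : MvPolynomial (Fin (d + 1)) ℂ) (hp : p ∈ weightSpace d n m) (h : D1 d p = 0) : p = 0 := by
  refine eq_zero_of_comp_eq_nonpos_smul (D2 d).toLinearMap (D1 d).toLinearMap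
    (fun m => weightSpace d n (-m)) (d * n) (fun m p hp => ?_) (fun m hm => ?_) (fun m p hp => ?_)
    (-m) (by omega) 0 le_rfl p (by rwa [neg_neg]) (by simp [h])
  · simpa [add_comm] using isWeightedHomogeneous_D2 d hp
  · exact weightSpace_eq_bot d n _ (by rw [abs_neg]; exact hm.trans_le (le_abs_self m))
  · have := D1_D2_sub_D2_D1 d n _ p hp
    rw [Derivation.coeFn_coe, Derivation.coeFn_coe, ← neg_sub, this, Int.cast_neg, neg_smul, neg_neg]

/-- The exponent vectors of degree `n` and weight at least `k`. -/
def exponentsGE (d n : ℕ) (k : ℤ) : Set (Fin (d + 1) →₀ ℕ) :=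
  {a | (weight (bidegree d) a).1 = n ∧ k ≤ (weight (bidegree d) a).2}

theorem finite_setOf_weight_fst (d n : ℕ) :
    {a : Fin (d + 1) →₀ ℕ | (weight (bidegree d) a).1 = n}.Finite := by
  refine (Finset.finite_toSet (Finset.finsuppAntidiag Finset.univ n)).subset fun a ha => ?_
  simpa [Finset.mem_finsuppAntidiag, weight_bidegree] using ha

instance (d n : ℕ) (m : ℤ) : FiniteDimensional ℂ (weightSpace d n m) := by
  rw [weightSpace, weightedHomogeneousSubmodule_eq_finsupp_supported]
  have : Finite {a | weight (bidegree d) a = (n, m)} :=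
    ((finite_setOf_weight_fst d n).subset fun a ha => by
      simp only [Set.mem_ofPred_eq] at ha ⊢; rw [ha]).to_subtype
  exact Module.Finite.of_basis (basisRestrictSupport ℂ {a | weight (bidegree d) a = (n, m)})

theorem exists_D1_eq_of_pos (d n : ℕ) (m : ℤ) (hm : 0 < m) (p : MvPolynomial (Fin (d + 1)) ℂ)
    (hp : p ∈ weightSpace d n m) : ∃ q ∈ weightSpace d n (m - 2), D1 d q = p := by
  have h2 (q) (hq : q ∈ weightSpace d n m) : D2 d q ∈ weightSpace d n (m - 2) := by
    simpa [sub_eq_add_neg] using isWeightedHomogeneous_D2 d hq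
  have h12 (q) (hq : q ∈ weightSpace d n m) : D1 d (D2 d q) ∈ weightSpace d n m := by
    simpa using isWeightedHomogeneous_D1 d (h2 q hq)
  let L : weightSpace d n m →ₗ[ℂ] weightSpace d n m :=
    ((D1 d).toLinearMap ∘ₗ (D2 d).toLinearMap).restrict h12
  have hL : Function.Injective L := by
    refine (injective_iff_map_eq_zero L).mpr fun q hq => Subtype.ext ?_
    refine eq_zero_of_comp_eq_nonpos_smul (D1 d).toLinearMap (D2 d).toLinearMap
      (weightSpace d n) (d * n) (fun m p hp => ?_) (fun m hm => ?_) (D1_D2_sub_D2_D1 d n)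
      m hm 0 le_rfl q q.2 ?_
    · simpa using isWeightedHomogeneous_D1 d hp
    · exact weightSpace_eq_bot d n _ (hm.trans_le (le_abs_self m))
    · simpa [L] using congrArg Subtype.val hq
  obtain ⟨q, hq⟩ := LinearMap.surjective_of_injective hL ⟨p, hp⟩
  exact ⟨D2 d q, h2 q q.2, congrArg Subtype.val hq⟩

theorem map_D1_restrictSupport (d n : ℕ) :
    (restrictSupport ℂ (exponentsGE d n 0)).map (D1 d).toLinearMap =
      restrictSupport ℂ (exponentsGE d n 2) := by
  classical
  apply le_antisymm
  · rw [restrictSupport_eq_span, Submodule.map_span, Submodule.span_le]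
    rintro _ ⟨_, ⟨a, ha, rfl⟩, rfl⟩
    refine (mem_restrictSupport_iff ℂ).mpr fun b hb => ?_
    have := isWeightedHomogeneous_D1 d (isWeightedHomogeneous_monomial (bidegree d) a (1 : ℂ) rfl)
      (MvPolynomial.mem_support_iff.mp hb)
    simp only [exponentsGE, Set.mem_ofPred_eq] at ha ⊢
    rw [this]
    exact ⟨ha.1, le_add_of_nonneg_left ha.2⟩
  · rw [restrictSupport_eq_span ℂ (exponentsGE d n 2), Submodule.span_le]
    rintro _ ⟨a, ha, rfl⟩
    obtain ⟨q, hq, h⟩ := exists_D1_eq_of_pos d n (weight (bidegree d) a).2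
      (two_pos.trans_le ha.2) (monomial a 1)
      (isWeightedHomogeneous_monomial _ a 1 (Prod.ext ha.1 rfl))
    refine ⟨q, (mem_restrictSupport_iff ℂ).mpr fun b hb => ?_, h⟩
    have := hq (MvPolynomial.mem_support_iff.mp hb)
    simp only [exponentsGE, Set.mem_ofPred_eq] at ha ⊢
    rw [this]
    exact ⟨rfl, sub_nonneg.mpr ha.2⟩

theorem Sn_eq_restrictSupport_inf_ker (d n : ℕ) :
    Sn d n = restrictSupport ℂ (exponentsGE d n 0) ⊓ LinearMap.ker (D1 d).toLinearMap := by
  classical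
  have hdeg (a : Fin (d + 1) →₀ ℕ) : (weight (bidegree d) a).1 = weight 1 a := by
    rw [weight_bidegree, weight_eq_sum]; simp
  ext p
  simp only [Sn, Submodule.mem_inf, LinearMap.mem_ker, and_congr_left_iff]
  intro hp
  constructor
  · intro hn
    refine (mem_restrictSupport_iff ℂ).mpr fun a ha => ⟨?_, ?_⟩
    · rw [hdeg]
      exact hn (MvPolynomial.mem_support_iff.mp ha)
    · by_contra! hneg
      have hcomp := weightedHomogeneousComponent_map (D1 d).toLinearMap
        (fun m p hp => isWeightedHomogeneous_D1 d hp) (weight (bidegree d) a) p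
      rw [hp, map_zero] at hcomp
      have h0 := eq_zero_of_D1_eq_zero_of_neg d _ _ hneg _
        (weightedHomogeneousComponent_mem (bidegree d) p (weight (bidegree d) a)) hcomp.symm
      have := coeff_weightedHomogeneousComponent (w := bidegree d) (weight (bidegree d) a) p a
      rw [h0, if_pos rfl, coeff_zero] at this
      exact MvPolynomial.mem_support_iff.mp ha this.symm
  · intro hs a ha
    have := ((mem_restrictSupport_iff ℂ).mp hs (MvPolynomial.mem_support_iff.mpr ha)).1
    rw [← hdeg, this]

theorem finrank_restrictSupport (d n : ℕ) (k : ℤ) :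
    Module.finrank ℂ (restrictSupport ℂ (exponentsGE d n k)) = (exponentsGE d n k).ncard :=
  Module.finrank_eq_nat_card_basis (basisRestrictSupport ℂ (exponentsGE d n k))

theorem finite_exponentsGE (d n : ℕ) (k : ℤ) : (exponentsGE d n k).Finite :=
  (finite_setOf_weight_fst d n).subset fun _ ha => ha.1

/-- The seminvariants of degree `n` are counted by the monomials of degree `n` and weight
`0` or `1`. -/
theorem finrank_Sn (d n : ℕ) :
    Module.finrank ℂ (Sn d n) = ((Finset.finsuppAntidiag Finset.univ n).filter
      fun a : Fin (d + 1) →₀ ℕ => (weight (bidegree d) a).2 = 0 ∨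
        (weight (bidegree d) a).2 = 1).card := by
  have := (finite_exponentsGE d n 0).to_subtype
  have : FiniteDimensional ℂ (restrictSupport ℂ (exponentsGE d n 0)) :=
    Module.Finite.of_basis (basisRestrictSupport ℂ _)
  have hrank := LinearMap.finrank_range_add_finrank_ker
    ((D1 d).toLinearMap.domRestrict (restrictSupport ℂ (exponentsGE d n 0)))
  rw [LinearMap.range_domRestrict, map_D1_restrictSupport, finrank_restrictSupport,
    finrank_restrictSupport, LinearMap.ker_domRestrict] at hrank
  have hker : Module.finrank ℂ (Sn d n) = Module.finrank ℂ ((LinearMap.ker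
      (D1 d).toLinearMap).comap (restrictSupport ℂ (exponentsGE d n 0)).subtype) := by
    rw [Sn_eq_restrictSupport_inf_ker, ← Submodule.map_comap_subtype]
    exact Submodule.finrank_map_subtype_eq _ _
  have hsub : exponentsGE d n 2 ⊆ exponentsGE d n 0 := fun a ha => ⟨ha.1, by have := ha.2; omega⟩
  have hdiff := Set.ncard_sdiff_add_ncard_of_subset hsub (finite_exponentsGE d n 0)
  have hset : exponentsGE d n 0 \ exponentsGE d n 2 = ((Finset.finsuppAntidiag Finset.univ n).filter
      fun a : Fin (d + 1) →₀ ℕ => (weight (bidegree d) a).2 = 0 ∨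
        (weight (bidegree d) a).2 = 1 : Finset _) := by
    ext a
    have : (weight (bidegree d) a).1 = Finset.univ.sum a := by rw [weight_bidegree]
    simp only [exponentsGE, Set.mem_sdiff, Set.mem_ofPred_eq, Finset.coe_filter,
      Finset.mem_finsuppAntidiag, Finset.subset_univ, and_true, this]
    omega
  rw [hset, Set.ncard_coe_finset] at hdiff
  omega

/-! ### Bivariate integer polynomials as coefficient tables -/

/-- The value at `z` of the polynomial with the given list of coefficients. -/
def evalRow {S : Type*} [CommRing S] (z : S) (r : List ℤ) : S :=
  r.foldr (fun (c : ℤ) (s : S) => c + z * s) 0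

/-- The value at `(z, q)` of a polynomial in `z` and `q` given by its table of coefficients, the
rows being indexed by the exponent of `q`. -/
def evalTable {S : Type*} [CommRing S] (z q : S) (t : List (List ℤ)) : S :=
  t.foldr (fun r s => evalRow z r + q * s) 0

/-- Addition of coefficient lists. -/
def addRow : List ℤ → List ℤ → List ℤ
  | [], m => m
  | l, [] => l
  | a :: l, b :: m => (a + b) :: addRow l m

/-- Addition of coefficient tables. -/
def addTable : List (List ℤ) → List (List ℤ) → List (List ℤ)
  | [], m => m
  | l, [] => l
  | a :: l, b :: m => addRow a b :: addTable l m

/-- Multiplication of a coefficient list by `-z ^ k`. -/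
def negShiftRow (k : ℕ) (r : List ℤ) : List ℤ :=
  List.replicate k 0 ++ r.map Neg.neg

/-- Multiplication of a coefficient table by `-z`. -/
def negShiftTable (t : List (List ℤ)) : List (List ℤ) :=
  t.map (negShiftRow 1)

/-- Multiplication of a coefficient table by `q ^ j`. -/
def shiftTable (j : ℕ) (t : List (List ℤ)) : List (List ℤ) :=
  List.replicate j [] ++ t

section Eval

variable {S : Type*} [CommRing S] (z q : S)

@[simp]
theorem evalRow_nil : evalRow z [] = 0 := rfl

@[simp]
theorem evalRow_cons (a : ℤ) (r : List ℤ) : evalRow z (a :: r) = a + z * evalRow z r := rfl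

@[simp]
theorem evalTable_nil : evalTable z q [] = 0 := rfl

@[simp]
theorem evalTable_cons (r : List ℤ) (t : List (List ℤ)) :
    evalTable z q (r :: t) = evalRow z r + q * evalTable z q t := rfl

theorem evalTable_zero_right (t : List (List ℤ)) :
    evalTable z 0 t = evalRow z (t.headD []) := by
  cases t <;> simp

theorem evalRow_addRow (l m : List ℤ) : evalRow z (addRow l m) = evalRow z l + evalRow z m := by
  induction l, m using addRow.induct with
  | case1 m => simp [addRow]
  | case2 l _ => simp [addRow]
  | case3 a l b m ih =>
    simp only [addRow, evalRow_cons, ih]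
    push_cast
    ring

theorem evalTable_addTable (l m : List (List ℤ)) :
    evalTable z q (addTable l m) = evalTable z q l + evalTable z q m := by
  induction l, m using addTable.induct with
  | case1 m => simp [addTable]
  | case2 l _ => simp [addTable]
  | case3 a l b m ih =>
    simp only [addTable, evalTable_cons, ih, evalRow_addRow]
    ring

theorem evalRow_negShiftRow (k : ℕ) (r : List ℤ) :
    evalRow z (negShiftRow k r) = -z ^ k * evalRow z r := by
  induction k with
  | zero =>
    induction r with
    | nil => simp [negShiftRow]
    | cons a r ih =>
      simp only [negShiftRow, List.replicate_zero, List.nil_append, List.map_cons,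
        evalRow_cons] at ih ⊢
      rw [ih]
      push_cast
      ring
  | succ k ih =>
    simp only [negShiftRow, List.replicate_succ, List.cons_append, evalRow_cons] at ih ⊢
    rw [ih]
    push_cast
    ring

theorem evalTable_negShiftTable (t : List (List ℤ)) :
    evalTable z q (negShiftTable t) = -z * evalTable z q t := by
  induction t with
  | nil => simp [negShiftTable]
  | cons r t ih =>
    simp only [negShiftTable, List.map_cons, evalTable_cons, evalRow_negShiftRow] at ih ⊢
    rw [ih]
    ring

theorem evalTable_shiftTable (j : ℕ) (t : List (List ℤ)) :
    evalTable z q (shiftTable j t) = q ^ j * evalTable z q t := by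
  induction j with
  | zero => simp [shiftTable]
  | succ j ih =>
    simp only [shiftTable, List.replicate_succ, List.cons_append, evalTable_cons] at ih ⊢
    rw [ih, evalRow_nil]
    ring

theorem evalTable_append (s t : List (List ℤ)) :
    evalTable z q (s ++ t) = evalTable z q s + q ^ s.length * evalTable z q t := by
  induction s with
  | nil => simp
  | cons r s ih =>
    simp only [List.cons_append, evalTable_cons, ih, List.length_cons]
    ring

theorem evalTable_reverse (q' : S) (h : q * q' = 1) (t : List (List ℤ)) :
    evalTable z q t.reverse * q' ^ t.length = q' * evalTable z q' t := by
  induction t with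
  | nil => simp
  | cons r t ih =>
    have hq : q ^ t.length * q' ^ t.length = 1 := by rw [← mul_pow, h, one_pow]
    simp only [List.reverse_cons, evalTable_append, List.length_reverse, evalTable_cons,
      evalTable_nil, List.length_cons]
    linear_combination q' * ih + q' * evalRow z r * hq

theorem evalRow_eq_zero (r : List ℤ) (h : r.all (· == 0)) : evalRow z r = 0 := by
  induction r with
  | nil => simp
  | cons a r ih =>
    simp only [List.all_cons, Bool.and_eq_true, beq_iff_eq] at h
    simp [h.1, ih h.2]

theorem evalTable_eq_zero (t : List (List ℤ)) (h : t.all fun r => r.all (· == 0)) :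
    evalTable z q t = 0 := by
  induction t with
  | nil => simp
  | cons r t ih =>
    simp only [List.all_cons, Bool.and_eq_true] at h
    simp [evalRow_eq_zero z r h.1, ih h.2]

theorem map_evalRow {S' : Type*} [CommRing S'] (φ : S →+* S') (r : List ℤ) :
    φ (evalRow z r) = evalRow (φ z) r := by
  induction r with
  | nil => simp
  | cons a r ih => simp [ih]

theorem map_evalTable {S' : Type*} [CommRing S'] (φ : S →+* S') (t : List (List ℤ)) :
    φ (evalTable z q t) = evalTable (φ z) (φ q) t := by
  induction t with
  | nil => simp
  | cons r t ih => simp [ih, map_evalRow]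

/-- Multiplication of a coefficient list by `1 - z ^ k`. -/
def mulOneSubRow (k : ℕ) (r : List ℤ) : List ℤ :=
  addRow r (negShiftRow k r)

/-- Multiplication of a coefficient table by `1 - z * q ^ j`. -/
def mulOneSubTable (j : ℕ) (t : List (List ℤ)) : List (List ℤ) :=
  addTable t (shiftTable j (negShiftTable t))

/-- Multiplication of a coefficient table by `q ^ j - z`. -/
def mulPowSubTable (j : ℕ) (t : List (List ℤ)) : List (List ℤ) :=
  addTable (shiftTable j t) (negShiftTable t)

theorem evalRow_mulOneSubRow (k : ℕ) (r : List ℤ) :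
    evalRow z (mulOneSubRow k r) = (1 - z ^ k) * evalRow z r := by
  rw [mulOneSubRow, evalRow_addRow, evalRow_negShiftRow]
  ring

theorem evalTable_mulOneSubTable (j : ℕ) (t : List (List ℤ)) :
    evalTable z q (mulOneSubTable j t) = (1 - z * q ^ j) * evalTable z q t := by
  rw [mulOneSubTable, evalTable_addTable, evalTable_shiftTable, evalTable_negShiftTable]
  ring

theorem evalTable_mulPowSubTable (j : ℕ) (t : List (List ℤ)) :
    evalTable z q (mulPowSubTable j t) = (q ^ j - z) * evalTable z q t := by
  rw [mulPowSubTable, evalTable_addTable, evalTable_shiftTable, evalTable_negShiftTable]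
  ring

end Eval

/-! ### The partial fraction decomposition -/

/-- The coefficients of
`(1 - z) (1 - z ^ 2) (1 - z ^ 4) (1 - z ^ 6) (1 - z ^ 8) (1 - z ^ 10) (1 - z ^ 12)`. -/
def denomRow : List ℤ :=
  [1, 2, 4, 6, 8, 10, 12].foldr mulOneSubRow [1]

/-- The numerator `N(z, q)` of the partial fraction decomposition, with respect to `q`, of
`(1 + q⁻¹) Q(z) / ∏ (1 - z q ^ j)`, where `j` runs over the odd integers from `-7` to `7` and `Q`
is the polynomial `denomRow`. The part that is regular at `q = 0` is
`N(z, q) / ∏_{j > 0} (1 - z q ^ j)`, and the other part is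
`q⁻¹ N(z, q⁻¹) / ∏_{j < 0} (1 - z q ^ j)`. -/
def numerTable : List (List ℤ) :=
  [[1, 0, 2, 6, 10, 19, 28, 44, 61, 79, 102, 129, 156, 173, 196, 215, 230, 231, 231, 230, 215,
    196, 173, 156, 129, 102, 79, 61, 44, 28, 19, 10, 6, 2, 0, 1],
   [0, 0, 3, 3, 4, 9, 10, 15, 14, 21, 26, 24, 21, 23, 26, 16, 11, 5, 4, -5, -18, -16, -17, -23,
    -30, -24, -20, -21, -18, -15, -9, -9, -5, -3, -1, 0, -1],
   [0, 1, 2, 2, 5, 8, 11, 12, 17, 24, 23, 20, 25, 27, 22, 14, 13, 9, 0, -10, -13, -11, -22, -28,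
    -25, -21, -23, -22, -17, -13, -11, -9, -5, -2, -2, -1],
   [0, 0, 1, 1, 0, -3, -10, -14, -24, -40, -61, -77, -101, -132, -155, -178, -200, -223, -234,
    -238, -236, -233, -222, -197, -177, -154, -126, -100, -77, -58, -41, -26, -14, -9, -4, -1, -1],
   [0, 1, 1, 0, 3, 1, 2, 6, 3, 2, 2, 2, 1, 0, -2, -4, -5, -7, -5, -6, -6, -5, -5, -3, -2, 4, 1,
    1, 3, 2, 4, 4, 3, 1, 2, 0, 0, 1],
   [0, 0, 0, -1, -4, -8, -14, -25, -42, -58, -77, -100, -128, -156, -176, -199, -222, -235, -234,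
    -239, -235, -221, -201, -176, -154, -129, -103, -76, -59, -41, -24, -15, -8, -4, -1, 1],
   [0, 1, 0, -2, -1, -2, -4, -9, -11, -12, -18, -22, -25, -21, -26, -29, -23, -12, -12, -13, 1,
    10, 13, 16, 23, 28, 25, 22, 24, 23, 17, 13, 11, 6, 5, 2, 1, 1],
   [0, 0, -2, -2, -5, -14, -23, -37, -52, -76, -99, -122, -151, -180, -204, -220, -233, -247,
    -249, -238, -224, -210, -184, -156, -129, -105, -81, -53, -36, -22, -13, -4, -1, 2, 3, 2, 1],
   [0, 0, 0, -1, -2, -3, -2, 1, 4, 13, 22, 36, 53, 81, 105, 129, 156, 184, 210, 224, 238, 249,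
    247, 233, 220, 204, 180, 151, 122, 99, 76, 52, 37, 23, 14, 5, 2, 2],
   [0, 0, -1, -1, -2, -5, -6, -11, -13, -17, -23, -24, -22, -25, -28, -23, -16, -13, -10, -1, 13,
    12, 12, 23, 29, 26, 21, 25, 22, 18, 12, 11, 9, 4, 2, 1, 2, 0, -1],
   [0, 0, 0, 0, -1, 1, 4, 8, 15, 24, 41, 59, 76, 103, 129, 154, 176, 201, 221, 235, 239, 234,
    235, 222, 199, 176, 156, 128, 100, 77, 58, 42, 25, 14, 8, 4, 1],
   [0, 0, -1, 0, 0, -2, -1, -3, -4, -4, -2, -3, -1, -1, -4, 2, 3, 5, 5, 6, 6, 5, 7, 5, 4, 2, 0,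
    -1, -2, -2, -2, -3, -6, -2, -1, -3, 0, -1, -1],
   [0, 0, 0, 1, 1, 4, 9, 14, 26, 41, 58, 77, 100, 126, 154, 177, 197, 222, 233, 236, 238, 234,
    223, 200, 178, 155, 132, 101, 77, 61, 40, 24, 14, 10, 3, 0, -1, -1],
   [0, 0, 0, 0, 1, 2, 2, 5, 9, 11, 13, 17, 22, 23, 21, 25, 28, 22, 11, 13, 10, 0, -9, -13, -14,
    -22, -27, -25, -20, -23, -24, -17, -12, -11, -8, -5, -2, -2, -1],
   [0, 0, 0, 1, 0, 1, 3, 5, 9, 9, 15, 18, 21, 20, 24, 30, 23, 17, 16, 18, 5, -4, -5, -11, -16,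
    -26, -23, -21, -24, -26, -21, -14, -15, -10, -9, -4, -3, -3],
   [0, 0, 0, 0, -1, 0, -2, -6, -10, -19, -28, -44, -61, -79, -102, -129, -156, -173, -196, -215,
    -230, -231, -231, -230, -215, -196, -173, -156, -129, -102, -79, -61, -44, -28, -19, -10, -6,
    -2, 0, -1]]

theorem all_eq_zero_numerTable :
    ((addTable (addTable ([1, 3, 5, 7].foldr mulPowSubTable numerTable)
      ([1, 3, 5, 7].foldr mulOneSubTable numerTable.reverse))
      (shiftTable 15 [denomRow.map Neg.neg, denomRow.map Neg.neg])).all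
        fun r => r.all (· == 0)) = true := by
  decide +kernel

theorem evalRow_denomRow {S : Type*} [CommRing S] (z : S) :
    evalRow z denomRow = (1 - z) * (1 - z ^ 2) * (1 - z ^ 4) * (1 - z ^ 6) * (1 - z ^ 8) *
      (1 - z ^ 10) * (1 - z ^ 12) := by
  simp only [denomRow, List.foldr_cons, List.foldr_nil, evalRow_mulOneSubRow, evalRow_cons,
    evalRow_nil]
  push_cast
  ring

theorem evalTable_numerTable_add {S : Type*} [CommRing S] (z q q' : S) (h : q * q' = 1) :
    evalTable z q numerTable *
        ((1 - z * q' ^ 1) * (1 - z * q' ^ 3) * (1 - z * q' ^ 5) * (1 - z * q' ^ 7)) +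
      q' * evalTable z q' numerTable *
        ((1 - z * q ^ 1) * (1 - z * q ^ 3) * (1 - z * q ^ 5) * (1 - z * q ^ 7)) =
      (1 + q') * evalRow z denomRow := by
  have hneg : evalRow z (denomRow.map Neg.neg) = -evalRow z denomRow := by
    simpa [negShiftRow] using evalRow_negShiftRow z 0 denomRow
  have key := evalTable_eq_zero z q _ all_eq_zero_numerTable
  simp only [evalTable_addTable, evalTable_shiftTable, List.foldr_cons, List.foldr_nil,
    evalTable_mulOneSubTable, evalTable_mulPowSubTable, evalTable_cons, evalTable_nil,
    hneg] at key
  have hrev := evalTable_reverse z q q' h numerTable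
  have hlen : numerTable.length = 16 := rfl
  rw [hlen] at hrev
  have hpow (j : ℕ) : (q ^ j - z) * q' ^ j = 1 - z * q' ^ j := by
    rw [sub_mul, ← mul_pow, h, one_pow]
  have h15 : q ^ 15 * q' ^ 15 = 1 := by rw [← mul_pow, h, one_pow]
  rw [← hpow 1, ← hpow 3, ← hpow 5, ← hpow 7, ← hrev]
  linear_combination q' ^ 16 * key + evalRow z denomRow * ((q' + q * q') * h15 + h)

/-! ### Constant terms -/

open LaurentPolynomial in
/-- The constant term with respect to `T` of a power series over the Laurent polynomials. -/
def constTerm (f : PowerSeries ℂ[T;T⁻¹]) : PowerSeries ℂ :=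
  PowerSeries.mk fun n => (PowerSeries.coeff n f).coeff 0

theorem constTerm_add (f g) : constTerm (f + g) = constTerm f + constTerm g := by
  ext n
  simp [constTerm]

theorem constTerm_mul_map_C (f) (g : PowerSeries ℂ) :
    constTerm (f * PowerSeries.map LaurentPolynomial.C g) = constTerm f * g := by
  ext n
  simp only [constTerm, PowerSeries.coeff_mk, PowerSeries.coeff_mul, PowerSeries.coeff_map,
    AddMonoidAlgebra.coeff_sum, Finsupp.finsetSum_apply]
  refine Finset.sum_congr rfl fun x _ => ?_
  rw [mul_comm, ← LaurentPolynomial.smul_eq_C_mul, mul_comm]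
  rfl

theorem constTerm_map_toLaurent (f : PowerSeries (Polynomial ℂ)) :
    constTerm (PowerSeries.map Polynomial.toLaurent f) =
      PowerSeries.map Polynomial.constantCoeff f := by
  ext n
  simp only [constTerm, PowerSeries.coeff_mk, PowerSeries.coeff_map,
    Polynomial.constantCoeff_apply]
  induction PowerSeries.coeff n f using Polynomial.induction_on' with
  | add p q hp hq =>
    rw [map_add, AddMonoidAlgebra.coeff_add, Finsupp.add_apply, hp, hq, Polynomial.coeff_add]
  | monomial k a =>
    rw [Polynomial.toLaurent_C_mul_T, ← LaurentPolynomial.single_eq_C_mul_T]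
    rw [AddMonoidAlgebra.coeff_single, Finsupp.single_apply, Polynomial.coeff_monomial]
    simp only [Nat.cast_eq_zero]

theorem constTerm_map_invert (f) :
    constTerm (PowerSeries.map (LaurentPolynomial.invert : _ ≃ₐ[ℂ] _).toRingEquiv.toRingHom f) =
      constTerm f := by
  ext n
  simp [constTerm]

/-- The geometric series `1 / (1 - u z)`. -/
def geomSeries {S : Type*} [CommRing S] (u : S) : PowerSeries S :=
  PowerSeries.mk fun k => u ^ k

theorem one_sub_mul_geomSeries {S : Type*} [CommRing S] (u : S) :
    (1 - PowerSeries.X * PowerSeries.C u) * geomSeries u = 1 := by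
  ext n
  rw [sub_mul, one_mul, map_sub, mul_assoc]
  cases n with
  | zero => simp [geomSeries]
  | succ n =>
    rw [PowerSeries.coeff_succ_X_mul, PowerSeries.coeff_C_mul]
    simp [geomSeries, pow_succ', PowerSeries.coeff_one]

theorem geomSeries_zero {S : Type*} [CommRing S] : geomSeries (0 : S) = 1 := by
  simpa using one_sub_mul_geomSeries (0 : S)

theorem map_geomSeries {S S' : Type*} [CommRing S] [CommRing S'] (φ : S →+* S') (u : S) :
    PowerSeries.map φ (geomSeries u) = geomSeries (φ u) := by
  ext n
  simp [geomSeries]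

/-- The generating series of all monomials by degree and weight. -/
def weightSeries (d : ℕ) : PowerSeries (LaurentPolynomial ℂ) :=
  ∏ i : Fin (d + 1), geomSeries (LaurentPolynomial.T ((d : ℤ) - 2 * i.val))

theorem coeff_weightSeries (d n : ℕ) : PowerSeries.coeff n (weightSeries d) =
    ∑ a ∈ Finset.finsuppAntidiag Finset.univ n,
      LaurentPolynomial.T (weight (bidegree d) a).2 := by
  classical
  rw [weightSeries, PowerSeries.coeff_prod]
  refine Finset.sum_congr rfl fun a _ => ?_
  rw [weight_bidegree]
  have h (s : Finset (Fin (d + 1))) (g : Fin (d + 1) → ℤ) :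
      (LaurentPolynomial.T (∑ i ∈ s, g i) : LaurentPolynomial ℂ) =
        ∏ i ∈ s, LaurentPolynomial.T (g i) := by
    induction s using Finset.induction_on with
    | empty => simp
    | insert i s hi ih => rw [Finset.sum_insert hi, Finset.prod_insert hi,
        LaurentPolynomial.T_add, ih]
  rw [h]
  exact Finset.prod_congr rfl fun i _ => by simp [geomSeries, mul_comm]

theorem PSeries_eq_constTerm (d : ℕ) :
    PSeries d = constTerm ((1 + PowerSeries.C (LaurentPolynomial.T (-1))) * weightSeries d) := by
  ext n
  rw [PSeries, PowerSeries.coeff_mk, finrank_Sn, constTerm, PowerSeries.coeff_mk, add_mul, one_mul,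
    map_add, PowerSeries.coeff_C_mul, coeff_weightSeries, Finset.mul_sum, ← Finset.sum_add_distrib,
    AddMonoidAlgebra.coeff_sum, Finsupp.finsetSum_apply, Finset.card_filter, Nat.cast_sum]
  refine Finset.sum_congr rfl fun a _ => ?_
  rw [← LaurentPolynomial.T_add, AddMonoidAlgebra.coeff_add, Finsupp.add_apply,
    LaurentPolynomial.T_apply, LaurentPolynomial.T_apply]
  split_ifs <;> first | omega | simp

theorem PSeries_seven_mul_denom :
    PSeries 7 * evalRow PowerSeries.X denomRow = evalRow PowerSeries.X (numerTable.headD []) := by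
  let q : PowerSeries (LaurentPolynomial ℂ) := PowerSeries.C (LaurentPolynomial.T 1)
  let q' : PowerSeries (LaurentPolynomial ℂ) := PowerSeries.C (LaurentPolynomial.T (-1))
  let θ : PowerSeries (Polynomial ℂ) →+* PowerSeries (LaurentPolynomial ℂ) :=
    PowerSeries.map Polynomial.toLaurent
  let σ : PowerSeries (LaurentPolynomial ℂ) →+* PowerSeries (LaurentPolynomial ℂ) :=
    PowerSeries.map (LaurentPolynomial.invert : _ ≃ₐ[ℂ] _).toRingEquiv.toRingHom
  let x : PowerSeries (Polynomial ℂ) := PowerSeries.C Polynomial.X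
  let G : PowerSeries (Polynomial ℂ) := geomSeries (Polynomial.X ^ 1) *
    geomSeries (Polynomial.X ^ 3) * geomSeries (Polynomial.X ^ 5) * geomSeries (Polynomial.X ^ 7)
  let U : PowerSeries (Polynomial ℂ) := evalTable PowerSeries.X x numerTable * G
  have hqq : q * q' = 1 := by
    simp only [q, q']
    rw [← map_mul, ← LaurentPolynomial.T_add]
    simp
  have hθx : θ x = q := by simp [θ, x, q]
  have hσq : σ q = q' := by simp [σ, q, q']
  have hθX : θ PowerSeries.X = PowerSeries.X := by simp [θ]
  have hσX : σ PowerSeries.X = PowerSeries.X := by simp [σ]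
  have hG : G * ((1 - PowerSeries.X * x ^ 1) * (1 - PowerSeries.X * x ^ 3) *
      (1 - PowerSeries.X * x ^ 5) * (1 - PowerSeries.X * x ^ 7)) = 1 := by
    have h (j : ℕ) := one_sub_mul_geomSeries ((Polynomial.X : Polynomial ℂ) ^ j)
    simp only [map_pow] at h
    calc _ = ((1 - PowerSeries.X * x ^ 1) * geomSeries (Polynomial.X ^ 1)) *
          ((1 - PowerSeries.X * x ^ 3) * geomSeries (Polynomial.X ^ 3)) *
          ((1 - PowerSeries.X * x ^ 5) * geomSeries (Polynomial.X ^ 5)) *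
          ((1 - PowerSeries.X * x ^ 7) * geomSeries (Polynomial.X ^ 7)) := by simp only [G]; ring
      _ = 1 := by simp only [x, h, mul_one]
  have hθG := congrArg θ hG
  have hσG := congrArg σ hθG
  simp only [map_mul, map_sub, map_pow, map_one, hθx, hθX, hσX, hσq] at hθG hσG
  have hF : weightSeries 7 = θ G * σ (θ G) := by
    simp only [weightSeries, Fin.prod_univ_succ, G, θ, σ, map_mul, map_geomSeries]
    simp
    ring
  have hdecomp : (1 + q') * weightSeries 7 * evalRow PowerSeries.X denomRow =
      θ U + σ (θ (x * U)) := by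
    have key := evalTable_numerTable_add PowerSeries.X q q' hqq
    simp only [U, map_mul, hF, map_evalTable, hθx, hθX, hσX, hσq]
    linear_combination (-θ G * σ (θ G)) * key + evalTable PowerSeries.X q numerTable * θ G * hσG +
      q' * evalTable PowerSeries.X q' numerTable * σ (θ G) * hθG
  have hQ : evalRow PowerSeries.X denomRow =
      PowerSeries.map LaurentPolynomial.C (evalRow (PowerSeries.X : PowerSeries ℂ) denomRow) := by
    rw [map_evalRow, PowerSeries.map_X]
  rw [PSeries_eq_constTerm, ← constTerm_mul_map_C, ← hQ, hdecomp, constTerm_add,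
    constTerm_map_invert, constTerm_map_toLaurent, constTerm_map_toLaurent]
  simp only [U, G, x, map_mul, map_evalTable, map_geomSeries, PowerSeries.map_X,
    PowerSeries.map_C, map_pow, Polynomial.constantCoeff_apply, Polynomial.coeff_X_zero, map_zero,
    zero_mul, add_zero]
  simp [geomSeries_zero, evalTable_zero_right]

/-- The Poincaré series of the algebra of covariants of the binary 7-form. -/
theorem poincare_series_d7 :
    PSeries 7 = (1 + 2 * (PowerSeries.X : PowerSeries ℂ) ^ 2 + 6 * (PowerSeries.X : PowerSeries ℂ) ^ 3 + 10 * (PowerSeries.X : PowerSeries ℂ) ^ 4 + 19 * (PowerSeries.X : PowerSeries ℂ) ^ 5 + 28 * (PowerSeries.X : PowerSeries ℂ) ^ 6 + 44 * (PowerSeries.X : PowerSeries ℂ) ^ 7 + 61 * (PowerSeries.X : PowerSeries ℂ) ^ 8 + 79 * (PowerSeries.X : PowerSeries ℂ) ^ 9 + 102 * (PowerSeries.X : PowerSeries ℂ) ^ 10 + 129 * (PowerSeries.X : PowerSeries ℂ) ^ 11 + 156 * (PowerSeries.X : PowerSeries ℂ) ^ 12 + 173 * (PowerSeries.X : PowerSeries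 ℂ) ^ 13 + 196 * (PowerSeries.X : PowerSeries ℂ) ^ 14 + 215 * (PowerSeries.X : PowerSeries ℂ) ^ 15 + 230 * (PowerSeries.X : PowerSeries ℂ) ^ 16 + 231 * (PowerSeries.X : PowerSeries ℂ) ^ 17 + 231 * (PowerSeries.X : PowerSeries ℂ) ^ 18 + 230 * (PowerSeries.X : PowerSeries ℂ) ^ 19 + 215 * (PowerSeries.X : PowerSeries ℂ) ^ 20 + 196 * (PowerSeries.X : PowerSeries ℂ) ^ 21 + 173 * (PowerSeries.X : PowerSeries ℂ) ^ 22 + 156 * (PowerSeries.X : PowerSeries ℂ) ^ 23 + 129 * (PowerSeries.X : PowerSeries ℂ) ^ 24 + 102 * (PowerSeries.X : PowerSeries ℂ) ^ 25 + 79 * (PowerSeries.X : PowerSeries ℂ) ^ 26 + 61 * (PowerSeries.X : PowerSeries ℂ) ^ 27 + 44 * (PowerSeries.X : PowerSeries ℂ) ^ 28 + 28 * (PowerSeries.X : PowerSeries ℂ) ^ 29 + 19 * (PowerSeries.X : PowerSeries ℂ) ^ 30 + 10 * (PowerSeries.X : PowerSeries ℂ) ^ 31 + 6 * (PowerSeries.X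 : PowerSeries ℂ) ^ 32 + 2 * (PowerSeries.X : PowerSeries ℂ) ^ 33 + (PowerSeries.X : PowerSeries ℂ) ^ 35) * ((1 - (PowerSeries.X : PowerSeries ℂ)) * (1 - (PowerSeries.X : PowerSeries ℂ) ^ 2) * (1 - (PowerSeries.X : PowerSeries ℂ) ^ 4) * (1 - (PowerSeries.X : PowerSeries ℂ) ^ 6) * (1 - (PowerSeries.X : PowerSeries ℂ) ^ 8) * (1 - (PowerSeries.X : PowerSeries ℂ) ^ 10) * (1 - (PowerSeries.X : PowerSeries ℂ) ^ 12))⁻¹ := by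
  rw [PowerSeries.eq_mul_inv_iff_mul_eq (by simp), ← evalRow_denomRow, PSeries_seven_mul_denom]
  simp only [numerTable, List.headD_cons, evalRow_cons, evalRow_nil]
  push_cast
  ring

end
end

section
/- For d = 10, the Poincaré series of the algebra of covariants of the binary 10-form satisfies P_10(z) = p_10(z)/((1 − z)(1 − z²)²(1 − z³)(1 − z⁴)(1 − z⁵)(1 − z⁶)(1 − z⁷)(1 − z⁸)(1 − z⁹)), where p_10(z) = z^{36} + 3z^{34} + 11z^{33} + 27z^{32} + 58z^{31} + 112z^{30} + 193z^{29} + 318z^{28} + 485z^{27} + 699z^{26} + 951z^{25} + 1245z^{24} + 1541z^{23} + 1842z^{22} + 2108z^{21} + 2321z^{20} + 2451z^{19} + 2506z^{18} + 2451z^{17} + 2321z^{16} + 2108z^{15} + 1842z^{14} + 1541z^{13} + 1245z^{12} + 951z^{11} + 699z^{10} + 485z^9 + 318z^8 + 193z^7 + 112z^6 + 58z^5 + 27z^4 + 11z^3 + 3z^2 + 1; i.e. ∑_{n≥0} dim(S_n) z^n = p_10(z) · ((1 − z)(1 − z²)²(1 − z³)(1 − z⁴)(1 − z⁵)(1 −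 z⁶)(1 − z⁷)(1 − z⁸)(1 − z⁹))^{−1} in ℂ[[z]]. -/
noncomputable section

namespace BinaryForm

open PowerSeries

/-! ### Integer polynomials as coefficient lists -/

/-- The power series with the given list of coefficients. -/
def ofList : List ℤ → PowerSeries ℂ
  | [] => 0
  | a :: l => C (a : ℂ) + X * ofList l

/-- Coefficientwise addition of lists. -/
def listAdd : List ℤ → List ℤ → List ℤ
  | [], b => b
  | a :: l, [] => a :: l
  | a :: l, b :: r => (a + b) :: listAdd l r

/-- Multiplication by `X ^ i` on coefficient lists. -/
def listShift (i : ℕ) (l : List ℤ) : List ℤ := List.replicate i 0 ++ l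

/-- The coefficient list of `p - X ^ i * q`. -/
def listSubShift (i : ℕ) (p q : List ℤ) : List ℤ := listAdd p ((listShift i q).map Neg.neg)

/-- Multiplication by `1 + X ^ i + ⋯ + X ^ (i * (c - 1))` on coefficient lists. -/
def listGeom (i : ℕ) : ℕ → List ℤ → List ℤ
  | 0, _ => []
  | c + 1, l => listAdd l (listShift i (listGeom i c l))

/-- The sublist of coefficients at multiples of `m`. -/
def listSect (m : ℕ) (l : List ℤ) : List ℤ :=
  (List.range l.length).map fun j => l.getD (m * j) 0

/-- Multiplication by `∏ i ∈ s, (1 - X ^ i)` on coefficient lists. -/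
def listMulProd (s : List ℕ) (l : List ℤ) : List ℤ := s.foldr (fun i r => listSubShift i r r) l

theorem ofList_add (p q : List ℤ) : ofList (listAdd p q) = ofList p + ofList q := by
  induction p generalizing q with
  | nil => simp [listAdd, ofList]
  | cons a l ih =>
    cases q with
    | nil => simp [listAdd, ofList]
    | cons b r => simp only [listAdd, ofList, ih, Int.cast_add, map_add]; ring

theorem ofList_shift (i : ℕ) (l : List ℤ) : ofList (listShift i l) = X ^ i * ofList l := by
  unfold listShift
  induction i with
  | zero => simp
  | succ i ih => rw [List.replicate_succ, List.cons_append, ofList, ih]; simp; ring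

theorem ofList_map_neg (l : List ℤ) : ofList (l.map Neg.neg) = -ofList l := by
  induction l with
  | nil => simp [ofList]
  | cons a l ih => rw [List.map_cons, ofList, ofList, ih]; simp; ring

theorem ofList_subShift (i : ℕ) (p q : List ℤ) :
    ofList (listSubShift i p q) = ofList p - X ^ i * ofList q := by
  rw [listSubShift, ofList_add, ofList_map_neg, ofList_shift, sub_eq_add_neg]

theorem one_sub_mul_ofList_geom (i c : ℕ) (l : List ℤ) :
    (1 - X ^ i) * ofList (listGeom i c l) = (1 - X ^ (i * c)) * ofList l := by
  induction c with
  | zero => simp [listGeom, ofList]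
  | succ c ih =>
    rw [listGeom, ofList_add, ofList_shift, mul_add, mul_left_comm, ih]; ring

theorem coeff_ofList (l : List ℤ) (n : ℕ) : coeff n (ofList l) = (l.getD n 0 : ℂ) := by
  induction l generalizing n with
  | nil => simp [ofList]
  | cons a l ih =>
    cases n with
    | zero => simp [ofList]
    | succ n => rw [ofList, map_add, coeff_succ_X_mul, ih, coeff_C]; simp

theorem ofList_eq_zero {l : List ℤ} (h : l.all (· = 0) = true) : ofList l = 0 := by
  induction l with
  | nil => rfl
  | cons a l ih =>
    simp only [List.all_cons, Bool.and_eq_true, decide_eq_true_eq] at h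
    rw [ofList, ih h.2, h.1]; simp

/-- The product of the `1 - X ^ i` over a list of exponents. -/
def prodOneSub (s : List ℕ) : PowerSeries ℂ := (s.map fun i => 1 - X ^ i).prod

theorem prodOneSub_cons (i : ℕ) (s : List ℕ) :
    prodOneSub (i :: s) = (1 - X ^ i) * prodOneSub s := by
  simp [prodOneSub]

theorem prodOneSub_append (s t : List ℕ) :
    prodOneSub (s ++ t) = prodOneSub s * prodOneSub t := by
  simp [prodOneSub]

theorem prodOneSub_perm {s t : List ℕ} (h : s.Perm t) : prodOneSub s = prodOneSub t :=
  (h.map _).prod_eq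

theorem constantCoeff_prodOneSub {s : List ℕ} (h : ∀ i ∈ s, i ≠ 0) :
    constantCoeff (prodOneSub s) = 1 := by
  induction s with
  | nil => simp [prodOneSub]
  | cons i s ih =>
    rw [prodOneSub_cons, map_mul, ih fun j hj => h j (List.mem_cons_of_mem _ hj)]
    simp [h i List.mem_cons_self]

theorem ofList_mulProd (s : List ℕ) (l : List ℤ) :
    ofList (listMulProd s l) = prodOneSub s * ofList l := by
  induction s with
  | nil => simp [listMulProd, prodOneSub]
  | cons i s ih =>
    rw [prodOneSub_cons, mul_assoc, ← ih, listMulProd, List.foldr_cons, ofList_subShift]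
    simp only [listMulProd]; ring

/-! ### Sections of power series -/

/-- The `m`-section `∑ a_{mn} X ^ n` of a power series `∑ a_n X ^ n`. -/
def sect (m : ℕ) (f : PowerSeries ℂ) : PowerSeries ℂ := mk fun n => coeff (m * n) f

theorem sect_mul_one_sub {m : ℕ} (hm : 0 < m) (i : ℕ) (f : PowerSeries ℂ) :
    sect m ((1 - X ^ (m * i)) * f) = (1 - X ^ i) * sect m f := by
  ext n
  rw [sub_mul, sub_mul, one_mul, one_mul, map_sub, sect, coeff_mk, map_sub, sect, coeff_mk,
    coeff_X_pow_mul', coeff_X_pow_mul']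
  simp only [mul_le_mul_iff_right₀ hm, coeff_mk, Nat.mul_sub]

theorem sect_mul_prodOneSub {m : ℕ} (hm : 0 < m) (s : List ℕ) (f : PowerSeries ℂ) :
    sect m (prodOneSub (s.map (m * ·)) * f) = prodOneSub s * sect m f := by
  induction s with
  | nil => simp [prodOneSub]
  | cons i s ih =>
    rw [List.map_cons, prodOneSub_cons, prodOneSub_cons, mul_assoc, sect_mul_one_sub hm, ih,
      mul_assoc]

theorem sect_ofList {m : ℕ} (hm : 0 < m) (l : List ℤ) :
    sect m (ofList l) = ofList (listSect m l) := by
  ext n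
  rw [sect, coeff_mk, coeff_ofList, coeff_ofList, listSect]
  rcases lt_or_ge n l.length with h | h
  · simp [List.getD_eq_getElem?_getD, h]
  · have : l.length ≤ m * n := h.trans (Nat.le_mul_of_pos_left n hm)
    simp [List.getD_eq_getElem?_getD, h, this]

/-- Multiplication by `∏ i ∈ s, (1 - X ^ lcm i m) / (1 - X ^ i)` on coefficient lists. -/
def listMulGeom (m : ℕ) (s : List ℕ) (l : List ℤ) : List ℤ :=
  s.foldr (fun i r => listGeom i (m / i.gcd m) r) l

theorem prodOneSub_mul_ofList_mulGeom (m : ℕ) (s : List ℕ) (l : List ℤ) :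
    prodOneSub s * ofList (listMulGeom m s l) =
      prodOneSub ((s.map fun i => i / i.gcd m).map (m * ·)) * ofList l := by
  induction s with
  | nil => simp [listMulGeom, prodOneSub]
  | cons i s ih =>
    have e : i * (m / i.gcd m) = m * (i / i.gcd m) := by
      rw [← Nat.mul_div_assoc _ (Nat.gcd_dvd_right i m),
        ← Nat.mul_div_assoc _ (Nat.gcd_dvd_left i m), mul_comm]
    rw [List.map_cons, List.map_cons, prodOneSub_cons, prodOneSub_cons, mul_assoc _ _ (ofList l),
      ← ih, ← e, listMulGeom, List.foldr_cons, mul_right_comm, one_sub_mul_ofList_geom, listMulGeom]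
    ring

theorem prodOneSub_mul_sect {m : ℕ} (hm : 0 < m) {s : List ℕ} (l : List ℤ)
    {g : PowerSeries ℂ} (hg : prodOneSub s * g = 1) :
    prodOneSub (s.map fun i => i / i.gcd m) * sect m (ofList l * g) =
      ofList (listSect m (listMulGeom m s l)) := by
  rw [← sect_mul_prodOneSub hm, ← mul_assoc, ← prodOneSub_mul_ofList_mulGeom, mul_right_comm, hg,
    one_mul, sect_ofList hm]

/-! ### The Gaussian binomial coefficients -/

/-- The coefficient list of the coefficient of `y ^ k` in `∏ i < j, (1 - y * X ^ (i + 1))`. -/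
def numer : ℕ → ℕ → List ℤ
  | 0, 0 => [1]
  | 0, _ + 1 => []
  | j + 1, 0 => numer j 0
  | j + 1, k + 1 => listSubShift (j + 1) (numer j (k + 1)) (numer j k)

theorem exists_prod_one_sub_eq (y : PowerSeries ℂ) (j : ℕ) :
    ∃ r, ∏ i ∈ Finset.range j, (1 - y * X ^ (i + 1)) =
      ∑ k ∈ Finset.range 5, y ^ k * ofList (numer j k) + X * y ^ 5 * r := by
  induction j with
  | zero => exact ⟨0, by simp [Finset.sum_range_succ, numer, ofList]⟩
  | succ j ih =>
    obtain ⟨r, hr⟩ := ih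
    refine ⟨(1 - y * X ^ (j + 1)) * r - X ^ j * ofList (numer j 4), ?_⟩
    rw [Finset.prod_range_succ, hr]
    simp only [Finset.sum_range_succ, Finset.sum_range_zero, numer, ofList_subShift]
    ring

/-- The generating function of monomials by degree (outer variable) and weight (inner one). -/
def bigraded (d : ℕ) : PowerSeries (PowerSeries ℂ) :=
  ∏ i ∈ Finset.range (d + 1), mk fun k => (X ^ i) ^ k

theorem one_sub_mul_geom (a : PowerSeries ℂ) : (1 - C a * X) * (mk fun k => a ^ k) = 1 := by
  ext n : 1
  rw [sub_mul, one_mul, map_sub, mul_assoc, coeff_C_mul]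
  cases n with
  | zero => simp
  | succ n => simp [coeff_succ_X_mul, coeff_one, pow_succ']

theorem bigraded_mul (d : ℕ) :
    bigraded d * C (∏ i ∈ Finset.range d, (1 - X ^ (i + 1))) =
      mk fun n => ∏ i ∈ Finset.range d, (1 - X ^ n * X ^ (i + 1)) := by
  induction d with
  | zero =>
    ext n : 1
    simp [bigraded]
  | succ d ih =>
    have key : (1 - C (X ^ (d + 1)) * X) *
        (mk fun n => ∏ i ∈ Finset.range (d + 1), (1 - X ^ n * X ^ (i + 1) : PowerSeries ℂ)) =
        C (1 - X ^ (d + 1)) * mk fun n => ∏ i ∈ Finset.range d, (1 - X ^ n * X ^ (i + 1)) := by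
      ext n : 1
      rw [sub_mul, one_mul, map_sub, mul_assoc, coeff_C_mul, coeff_C_mul]
      cases n with
      | zero => simp [Finset.prod_range_succ]; ring
      | succ n =>
        rw [coeff_succ_X_mul, coeff_mk, coeff_mk, coeff_mk, Finset.prod_range_succ,
          Finset.prod_range_succ' _ d]
        have : ∀ i, X ^ n * X ^ (i + 1 + 1) = (X ^ (n + 1) * X ^ (i + 1) : PowerSeries ℂ) :=
          fun i => by ring
        simp only [this]
        ring
    have h0 : (1 - C (X ^ (d + 1)) * X : PowerSeries (PowerSeries ℂ)) ≠ 0 :=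
      left_ne_zero_of_mul_eq_one (one_sub_mul_geom _)
    apply mul_left_cancel₀ h0
    rw [key, ← ih, bigraded, Finset.prod_range_succ _ (d + 1),
      Finset.prod_range_succ (fun i => (1 - X ^ (i + 1) : PowerSeries ℂ)) d, map_mul, bigraded]
    linear_combination (C (1 - X ^ (d + 1)) * C (∏ i ∈ Finset.range d, (1 - X ^ (i + 1))) *
      ∏ i ∈ Finset.range (d + 1), mk fun k => (X ^ i) ^ k) * one_sub_mul_geom (X ^ (d + 1))

theorem coeff_bigraded (d n w : ℕ) :
    coeff w (coeff n (bigraded d)) =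
      (((Finset.univ : Finset (Fin (d + 1))).finsuppAntidiag n).filter
        fun a => ∑ i, i.val * a i = w).card := by
  rw [bigraded, ← Fin.prod_univ_eq_prod_range (fun i => mk fun k => (X ^ i) ^ k), coeff_prod,
    Finset.card_filter]
  simp only [map_sum, coeff_mk, ← pow_mul, Finset.prod_pow_eq_pow_sum, coeff_X_pow, Nat.cast_sum,
    Nat.cast_ite, Nat.cast_one, Nat.cast_zero, eq_comm (a := w)]

theorem mk_coeff_bigraded {g : PowerSeries ℂ}
    (hg : prodOneSub [1, 2, 3, 4, 5, 6, 7, 8, 9, 10] * g = 1) :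
    (mk fun n => coeff (5 * n) (coeff n (bigraded 10))) =
      ∑ k ∈ Finset.range 5, sect (5 - k) (ofList (numer 10 k) * g) := by
  have hD : ∏ i ∈ Finset.range 10, (1 - X ^ (i + 1) : PowerSeries ℂ) =
      prodOneSub [1, 2, 3, 4, 5, 6, 7, 8, 9, 10] := by
    simp [Finset.prod_range_succ, prodOneSub, mul_assoc]
  ext n
  have h := congrArg (coeff n) (bigraded_mul 10)
  rw [hD, coeff_mul_C, coeff_mk] at h
  obtain ⟨r, hr⟩ := exists_prod_one_sub_eq (X ^ n) 10
  rw [hr] at h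
  have h' : coeff n (bigraded 10) = ∑ k ∈ Finset.range 5,
      X ^ (n * k) * (ofList (numer 10 k) * g) + X ^ (5 * n + 1) * (r * g) := by
    calc _ = coeff n (bigraded 10) * (prodOneSub [1, 2, 3, 4, 5, 6, 7, 8, 9, 10] * g) := by
          rw [hg, mul_one]
      _ = _ := by
          rw [← mul_assoc, h, add_mul, Finset.sum_mul]
          congr 1
          · exact Finset.sum_congr rfl fun k _ => by rw [← pow_mul, mul_assoc]
          · ring
  rw [coeff_mk, h', map_add, coeff_X_pow_mul', if_neg (by omega), add_zero, map_sum, map_sum]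
  refine Finset.sum_congr rfl fun k hk => ?_
  have hk := Finset.mem_range.mp hk
  rw [coeff_X_pow_mul', if_pos (by nlinarith), sect, coeff_mk, Nat.sub_mul, mul_comm n k]

/-- The coefficient list of the numerator of the Poincaré series of the binary 10-form. -/
def decicNumer : List ℤ :=
  [1, 0, 3, 11, 27, 58, 112, 193, 318, 485, 699, 951, 1245, 1541, 1842, 2108, 2321, 2451, 2506,
    2451, 2321, 2108, 1842, 1541, 1245, 951, 699, 485, 318, 193, 112, 58, 27, 11, 3, 0, 1]

/-- The coefficient list of the part of the numerator (over a common denominator) contributed by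
the `k`-th term of the Gaussian binomial coefficient, with cofactor `c`. -/
def decicPart (k : ℕ) (c : List ℕ) : List ℤ :=
  listMulProd c (listSect (5 - k)
    (listMulGeom (5 - k) [1, 2, 3, 4, 5, 6, 7, 8, 9, 10] (numer 10 k)))

theorem decic_identity :
    (listSubShift 0 (listMulProd [1, 1, 3, 5, 10] decicNumer)
      (listAdd (decicPart 0 [1, 3, 5, 5, 10]) (listAdd (decicPart 1 [2, 4, 6, 8, 10])
        (listAdd (decicPart 2 [1, 3, 5, 6, 9]) (listAdd (decicPart 3 [1, 2, 6, 8, 10])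
          (decicPart 4 [1, 1, 2, 3, 5])))))).all (· = 0) = true := by
  decide +kernel

theorem prodOneSub_mul_sect_of_perm {g : PowerSeries ℂ} {k : ℕ} {c t : List ℕ}
    (hg : prodOneSub [1, 2, 3, 4, 5, 6, 7, 8, 9, 10] * g = 1) (hk : k < 5)
    (h : t.Perm (c ++ [1, 2, 3, 4, 5, 6, 7, 8, 9, 10].map fun i => i / i.gcd (5 - k))) :
    prodOneSub t * sect (5 - k) (ofList (numer 10 k) * g) = ofList (decicPart k c) := by
  rw [prodOneSub_perm h, prodOneSub_append, mul_assoc, prodOneSub_mul_sect (by omega) _ hg,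
    decicPart, ofList_mulProd]

theorem prodOneSub_mul_mk_coeff_bigraded :
    prodOneSub [1, 2, 2, 3, 4, 5, 6, 7, 8, 9] *
      (mk fun n => coeff (5 * n) (coeff n (bigraded 10))) = ofList decicNumer := by
  have hg : prodOneSub [1, 2, 3, 4, 5, 6, 7, 8, 9, 10] *
      (prodOneSub [1, 2, 3, 4, 5, 6, 7, 8, 9, 10])⁻¹ = 1 :=
    PowerSeries.mul_inv_cancel _ (by rw [constantCoeff_prodOneSub (by simp)]; exact one_ne_zero)
  have hc : prodOneSub [1, 1, 3, 5, 10] ≠ 0 := fun h => by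
    simpa [h] using constantCoeff_prodOneSub (s := [1, 1, 3, 5, 10]) (by simp)
  apply mul_left_cancel₀ hc
  have hid := ofList_eq_zero decic_identity
  simp only [ofList_subShift, ofList_add, ofList_mulProd, pow_zero, one_mul] at hid
  rw [sub_eq_zero.mp hid, ← mul_assoc, ← prodOneSub_append, mk_coeff_bigraded hg, Finset.mul_sum]
  simp only [Finset.sum_range_succ, Finset.sum_range_zero, zero_add]
  rw [prodOneSub_mul_sect_of_perm (c := [1, 3, 5, 5, 10]) hg (by omega) (by decide),
    prodOneSub_mul_sect_of_perm (c := [2, 4, 6, 8, 10]) hg (by omega) (by decide),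
    prodOneSub_mul_sect_of_perm (c := [1, 3, 5, 6, 9]) hg (by omega) (by decide),
    prodOneSub_mul_sect_of_perm (c := [1, 2, 6, 8, 10]) hg (by omega) (by decide),
    prodOneSub_mul_sect_of_perm (c := [1, 1, 2, 3, 5]) hg (by omega) (by decide)]
  ring

theorem ofList_decicNumer : ofList decicNumer =
    (1 + 3 * X ^ 2 + 11 * X ^ 3 + 27 * X ^ 4 + 58 * X ^ 5 + 112 * X ^ 6 + 193 * X ^ 7 + 318 *
      X ^ 8 + 485 * X ^ 9 + 699 * X ^ 10 + 951 * X ^ 11 + 1245 * X ^ 12 + 1541 * X ^ 13 + 1842 *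
      X ^ 14 + 2108 * X ^ 15 + 2321 * X ^ 16 + 2451 * X ^ 17 + 2506 * X ^ 18 + 2451 * X ^ 19 +
      2321 * X ^ 20 + 2108 * X ^ 21 + 1842 * X ^ 22 + 1541 * X ^ 23 + 1245 * X ^ 24 + 951 * X ^
      25 + 699 * X ^ 26 + 485 * X ^ 27 + 318 * X ^ 28 + 193 * X ^ 29 + 112 * X ^ 30 + 58 * X ^
      31 + 27 * X ^ 32 + 11 * X ^ 33 + 3 * X ^ 34 + X ^ 36) := by
  simp only [decicNumer, ofList, map_intCast]
  simp
  ring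

theorem prodOneSub_decicDenom : prodOneSub [1, 2, 2, 3, 4, 5, 6, 7, 8, 9] =
    ((1 - X) * (1 - X ^ 2) ^ 2 * (1 - X ^ 3) * (1 - X ^ 4) * (1 - X ^ 5) * (1 - X ^ 6) * (1 -
      X ^ 7) * (1 - X ^ 8) * (1 - X ^ 9)) := by
  simp [prodOneSub]
  ring

end BinaryForm

namespace BinaryForm

open MvPolynomial

variable {d : ℕ}

/-! ### Diagonal derivations -/

theorem coeff_mkDerivation_smul_X (c : Fin (d + 1) → ℂ) (a : Fin (d + 1) →₀ ℕ)
    (p : MvPolynomial (Fin (d + 1)) ℂ) :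
    coeff a (mkDerivation ℂ (fun i => c i • X i) p) = (∑ i, c i * a i) * coeff a p := by
  induction p using MvPolynomial.induction_on' with
  | add p q hp hq => rw [map_add, coeff_add, hp, hq, coeff_add, mul_add]
  | monomial b r =>
    have key : mkDerivation ℂ (fun i => c i • X i) (monomial b r) =
        (∑ i, c i * b i) • monomial b r := by
      rw [mkDerivation_monomial, Finsupp.sum_fintype _ _ (by simp), Finset.sum_smul,
        Finset.smul_sum]
      refine Finset.sum_congr rfl fun i _ => ?_
      rcases Nat.eq_zero_or_pos (b i) with h | h
      · simp [h]
      · have hb : b - Finsupp.single i 1 + Finsupp.single i 1 = b :=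
          tsub_add_cancel_of_le (Finsupp.single_le_iff.mpr h)
        rw [smul_eq_mul, mul_smul_comm, X, monomial_mul, hb, smul_monomial, smul_monomial,
          smul_monomial]
        congr 1
        simp only [smul_eq_mul]
        ring
    rw [key, coeff_smul, coeff_monomial]
    split_ifs with h
    · rw [h, smul_eq_mul]
    · simp

/-- The Euler derivation, acting by the degree. -/
def eulerD (d : ℕ) :
    Derivation ℂ (MvPolynomial (Fin (d + 1)) ℂ) (MvPolynomial (Fin (d + 1)) ℂ) :=
  mkDerivation ℂ fun i => (1 : ℂ) • X i

/-- The derivation acting by the weight `∑ i * a_i` on the monomial `x ^ a`. -/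
def weightD (d : ℕ) :
    Derivation ℂ (MvPolynomial (Fin (d + 1)) ℂ) (MvPolynomial (Fin (d + 1)) ℂ) :=
  mkDerivation ℂ fun i => (i.val : ℂ) • X i

/-- The raising derivation `x_i ↦ (d - i) * x_{i+1}`, adjoint to `D1`. -/
def D2 (d : ℕ) :
    Derivation ℂ (MvPolynomial (Fin (d + 1)) ℂ) (MvPolynomial (Fin (d + 1)) ℂ) :=
  mkDerivation ℂ fun i => ((d : ℂ) - i.val) • X (i + 1)

/-- The weight of an exponent vector. -/
def wt (a : Fin (d + 1) →₀ ℕ) : ℕ := ∑ i, i.val * a i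

theorem wt_le (a : Fin (d + 1) →₀ ℕ) : wt a ≤ d * ∑ i, a i := by
  rw [wt, Finset.mul_sum]
  exact Finset.sum_le_sum fun i _ => Nat.mul_le_mul_right _ (Nat.lt_succ_iff.mp i.isLt)

theorem coeff_eulerD (a : Fin (d + 1) →₀ ℕ) (p : MvPolynomial (Fin (d + 1)) ℂ) :
    coeff a (eulerD d p) = ((∑ i, a i : ℕ) : ℂ) * coeff a p := by
  rw [eulerD, coeff_mkDerivation_smul_X]; simp

theorem coeff_weightD (a : Fin (d + 1) →₀ ℕ) (p : MvPolynomial (Fin (d + 1)) ℂ) :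
    coeff a (weightD d p) = (wt a : ℂ) * coeff a p := by
  rw [weightD, coeff_mkDerivation_smul_X, wt]; simp

theorem eulerD_D1 (p : MvPolynomial (Fin (d + 1)) ℂ) :
    eulerD d (D1 d p) = D1 d (eulerD d p) := by
  have h : ⁅eulerD d, D1 d⁆ = 0 := derivation_ext fun i => by
    simp [Derivation.commutator_apply, eulerD, D1]
  have := congrArg (fun D => D p) h
  simpa [Derivation.commutator_apply, sub_eq_zero] using this

theorem eulerD_D2 (p : MvPolynomial (Fin (d + 1)) ℂ) :
    eulerD d (D2 d p) = D2 d (eulerD d p) := by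
  have h : ⁅eulerD d, D2 d⁆ = 0 := derivation_ext fun i => by
    simp [Derivation.commutator_apply, eulerD, D2]
  have := congrArg (fun D => D p) h
  simpa [Derivation.commutator_apply, sub_eq_zero] using this

theorem weightD_D1 (p : MvPolynomial (Fin (d + 1)) ℂ) :
    weightD d (D1 d p) = D1 d (weightD d p) - D1 d p := by
  have h : ⁅weightD d, D1 d⁆ = -D1 d := derivation_ext fun i => by
    rw [Derivation.commutator_apply, Derivation.neg_apply]
    simp only [weightD, D1, mkDerivation_X, Derivation.map_smul, smul_smul]
    rcases eq_or_ne i 0 with rfl | hi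
    · simp
    · have : ((i - 1).val : ℂ) = i.val - 1 := by
        rw [Fin.val_sub_one_of_ne_zero hi, Nat.cast_sub, Nat.cast_one]
        exact Nat.one_le_iff_ne_zero.mpr fun h => hi (Fin.ext h)
      rw [this]
      module
  have := congrArg (fun D => D p) h
  simp only [Derivation.commutator_apply, Derivation.neg_apply] at this
  linear_combination this

theorem fin_val_add_one_smul (i : Fin (d + 1)) (p : MvPolynomial (Fin (d + 1)) ℂ) (c : ℂ) :
    (((d : ℂ) - i.val) * ((i + 1).val + c)) • p = (((d : ℂ) - i.val) * (i.val + 1 + c)) • p := by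
  rcases eq_or_ne i (Fin.last d) with rfl | hi
  · simp
  · rw [Fin.val_add_one_of_lt (Fin.lt_last_iff_ne_last.mpr hi)]
    simp

theorem weightD_D2 (p : MvPolynomial (Fin (d + 1)) ℂ) :
    weightD d (D2 d p) = D2 d (weightD d p) + D2 d p := by
  have h : ⁅weightD d, D2 d⁆ = D2 d := derivation_ext fun i => by
    rw [Derivation.commutator_apply]
    simp only [weightD, D2, mkDerivation_X, Derivation.map_smul, smul_smul]
    have := fin_val_add_one_smul i (X (i + 1)) 0
    simp only [add_zero] at this
    rw [this]
    module
  have := congrArg (fun D => D p) h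
  simp only [Derivation.commutator_apply] at this
  linear_combination this

theorem D1_D2 (p : MvPolynomial (Fin (d + 1)) ℂ) :
    D1 d (D2 d p) = D2 d (D1 d p) + ((d : ℂ) • eulerD d p - (2 : ℂ) • weightD d p) := by
  have h : ⁅D1 d, D2 d⁆ = (d : ℂ) • eulerD d - (2 : ℂ) • weightD d := derivation_ext fun i => by
    rw [Derivation.commutator_apply]
    simp only [weightD, eulerD, D1, D2, mkDerivation_X, Derivation.map_smul, smul_smul,
      Derivation.sub_apply, Derivation.smul_apply, add_sub_cancel_right, sub_add_cancel]
    have := fin_val_add_one_smul i (X i) 0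
    simp only [add_zero] at this
    rw [this]
    rcases eq_or_ne i 0 with rfl | hi
    · simp
    · have : ((i - 1).val : ℂ) = i.val - 1 := by
        rw [Fin.val_sub_one_of_ne_zero hi, Nat.cast_sub, Nat.cast_one]
        exact Nat.one_le_iff_ne_zero.mpr fun h => hi (Fin.ext h)
      rw [this]
      module
  have := congrArg (fun D => D p) h
  simp only [Derivation.commutator_apply, Derivation.sub_apply, Derivation.smul_apply] at this
  linear_combination this

/-! ### Weight spaces -/

/-- The polynomials that are homogeneous of degree `n` and weight `w`. -/
def weightSpace (d : ℕ) (n w : ℂ) : Submodule ℂ (MvPolynomial (Fin (d + 1)) ℂ) where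
  carrier := {p | eulerD d p = n • p ∧ weightD d p = w • p}
  zero_mem' := by simp
  add_mem' := fun hp hq => by simp_all
  smul_mem' := fun c p hp => by
    simp only [Set.mem_ofPred_eq, Derivation.map_smul] at hp ⊢
    rw [hp.1, hp.2, smul_comm c n, smul_comm c w]
    exact ⟨rfl, rfl⟩

theorem eq_of_mem_weightSpace {n w : ℂ} {p : MvPolynomial (Fin (d + 1)) ℂ}
    (hp : p ∈ weightSpace d n w) {a : Fin (d + 1) →₀ ℕ} (ha : coeff a p ≠ 0) :
    ((∑ i, a i : ℕ) : ℂ) = n ∧ (wt a : ℂ) = w := by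
  have h1 := congrArg (coeff a) hp.1
  have h2 := congrArg (coeff a) hp.2
  rw [coeff_eulerD, coeff_smul, smul_eq_mul] at h1
  rw [coeff_weightD, coeff_smul, smul_eq_mul] at h2
  exact ⟨mul_right_cancel₀ ha h1, mul_right_cancel₀ ha h2⟩

theorem monomial_mem_weightSpace (a : Fin (d + 1) →₀ ℕ) (r : ℂ) :
    monomial a r ∈ weightSpace d (∑ i, a i : ℕ) (wt a) := by
  constructor <;> ext b
  · rw [coeff_eulerD, coeff_smul, coeff_monomial, smul_eq_mul]; split_ifs with h <;> simp [h]
  · rw [coeff_weightD, coeff_smul, coeff_monomial, smul_eq_mul]; split_ifs with h <;> simp [h]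

theorem exists_nat_of_mem_weightSpace {n : ℕ} {w : ℂ} {p : MvPolynomial (Fin (d + 1)) ℂ}
    (hp : p ∈ weightSpace d n w) (h0 : p ≠ 0) : ∃ k : ℕ, k ≤ d * n ∧ w = k := by
  obtain ⟨a, ha⟩ := MvPolynomial.ne_zero_iff.mp h0
  obtain ⟨h1, h2⟩ := eq_of_mem_weightSpace hp ha
  refine ⟨wt a, ?_, h2.symm⟩
  rw [← Nat.cast_injective h1]
  exact wt_le a

theorem D1_mem_weightSpace {n w : ℂ} {p : MvPolynomial (Fin (d + 1)) ℂ}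
    (hp : p ∈ weightSpace d n w) : D1 d p ∈ weightSpace d n (w - 1) := by
  constructor
  · rw [eulerD_D1, hp.1, Derivation.map_smul]
  · rw [weightD_D1, hp.2, Derivation.map_smul, sub_smul, one_smul]

theorem D2_mem_weightSpace {n w : ℂ} {p : MvPolynomial (Fin (d + 1)) ℂ}
    (hp : p ∈ weightSpace d n w) : D2 d p ∈ weightSpace d n (w + 1) := by
  constructor
  · rw [eulerD_D2, hp.1, Derivation.map_smul]
  · rw [weightD_D2, hp.2, Derivation.map_smul, add_smul, one_smul]

theorem D1_iterate_mem_weightSpace {n w : ℂ} {p : MvPolynomial (Fin (d + 1)) ℂ}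
    (hp : p ∈ weightSpace d n w) (k : ℕ) : (D1 d)^[k] p ∈ weightSpace d n (w - k) := by
  induction k with
  | zero => simpa using hp
  | succ k ih =>
    rw [Function.iterate_succ_apply', Nat.cast_succ, ← sub_sub]
    exact D1_mem_weightSpace ih

theorem D2_iterate_mem_weightSpace {n w : ℂ} {p : MvPolynomial (Fin (d + 1)) ℂ}
    (hp : p ∈ weightSpace d n w) (k : ℕ) : (D2 d)^[k] p ∈ weightSpace d n (w + k) := by
  induction k with
  | zero => simpa using hp
  | succ k ih =>
    rw [Function.iterate_succ_apply', Nat.cast_succ, ← add_assoc]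
    exact D2_mem_weightSpace ih

theorem D1_D2_of_mem {n w : ℂ} {p : MvPolynomial (Fin (d + 1)) ℂ}
    (hp : p ∈ weightSpace d n w) :
    D1 d (D2 d p) = D2 d (D1 d p) + (d * n - 2 * w) • p := by
  rw [D1_D2, hp.1, hp.2]; module

theorem D1_D2_iterate {n w : ℂ} {p : MvPolynomial (Fin (d + 1)) ℂ}
    (hp : p ∈ weightSpace d n w) (h0 : D1 d p = 0) (k : ℕ) :
    D1 d ((D2 d)^[k + 1] p) = ((k + 1) * (d * n - 2 * w - k)) • (D2 d)^[k] p := by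
  induction k with
  | zero =>
    rw [Function.iterate_succ_apply', Function.iterate_zero_apply, D1_D2_of_mem hp, h0, map_zero]
    simp
  | succ k ih =>
    rw [Function.iterate_succ_apply', D1_D2_of_mem (D2_iterate_mem_weightSpace hp (k + 1)), ih,
      Derivation.map_smul, ← Function.iterate_succ_apply' (D2 d), ← add_smul]
    congr 1
    push_cast
    ring

theorem D1_iterate_D2 {n w : ℂ} {p : MvPolynomial (Fin (d + 1)) ℂ}
    (hp : p ∈ weightSpace d n w) (k : ℕ) :
    (D1 d)^[k + 1] (D2 d p) =
      D2 d ((D1 d)^[k + 1] p) + ((k + 1) * (d * n - 2 * w + k)) • (D1 d)^[k] p := by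
  induction k with
  | zero => simp [D1_D2_of_mem hp]
  | succ k ih =>
    rw [Function.iterate_succ_apply' (D1 d) (k + 1), ih, map_add, Derivation.map_smul,
      D1_D2_of_mem (D1_iterate_mem_weightSpace hp (k + 1)),
      ← Function.iterate_succ_apply' (D1 d) k, ← Function.iterate_succ_apply' (D1 d) (k + 1),
      add_assoc, ← add_smul]
    congr 2
    push_cast
    ring

theorem eq_zero_of_D1_eq_zero {n w : ℕ} (hw : d * n < 2 * w) {p : MvPolynomial (Fin (d + 1)) ℂ}
    (hp : p ∈ weightSpace d n w) (h0 : D1 d p = 0) : p = 0 := by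
  have step : ∀ k, (D2 d)^[k] p = 0 → p = 0 := by
    intro k
    induction k with
    | zero => exact id
    | succ k ih =>
      intro hk
      have h := D1_D2_iterate hp h0 k
      rw [hk, map_zero, eq_comm, smul_eq_zero] at h
      refine ih (h.resolve_left (mul_ne_zero (Nat.cast_add_one_ne_zero k) fun h => ?_))
      have : ((d * n : ℕ) : ℂ) = ((2 * w + k : ℕ) : ℂ) := by
        push_cast; linear_combination h
      have := Nat.cast_injective this
      omega
  refine step (d * n + 1) (by_contra fun h => ?_)
  obtain ⟨k, hk, e⟩ := exists_nat_of_mem_weightSpace (D2_iterate_mem_weightSpace hp _) h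
  have := Nat.cast_injective (R := ℂ) ((Nat.cast_add _ _).trans e)
  omega

theorem exists_D1_eq {n w : ℕ} (hw : 2 * w < d * n) {p : MvPolynomial (Fin (d + 1)) ℂ}
    (hp : p ∈ weightSpace d n w) : ∃ q ∈ weightSpace d n (w + 1), D1 d q = p := by
  have step : ∀ k, ∀ p ∈ weightSpace d n w, (D1 d)^[k] p = 0 →
      ∃ q ∈ weightSpace d n (w + 1), D1 d q = p := by
    intro k
    induction k with
    | zero => exact fun p _ h => ⟨0, zero_mem _, by rw [map_zero]; exact h.symm⟩
    | succ k ih =>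
      intro p hp h
      have hc : ((k + 1) * (d * n - 2 * w + k) : ℂ) ≠ 0 := by
        refine mul_ne_zero (Nat.cast_add_one_ne_zero k) fun h => ?_
        have : ((d * n + k : ℕ) : ℂ) = ((2 * w : ℕ) : ℂ) := by
          push_cast; linear_combination h
        have := Nat.cast_injective this
        omega
      have hD := D1_mem_weightSpace (D2_mem_weightSpace hp)
      rw [add_sub_cancel_right] at hD
      obtain ⟨q, hq, e⟩ := ih
        (D1 d (D2 d p) - ((k + 1) * (d * n - 2 * w + k) : ℂ) • p)
        (sub_mem hD (Submodule.smul_mem _ _ hp)) (by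
          rw [← Derivation.coeFn_coe, ← Module.End.coe_pow, map_sub, map_smul, Module.End.coe_pow,
            Derivation.coeFn_coe, ← Function.iterate_succ_apply, D1_iterate_D2 hp, h, map_zero,
            zero_add, sub_self])
      refine ⟨((k + 1) * (d * n - 2 * w + k) : ℂ)⁻¹ • (D2 d p - q),
        Submodule.smul_mem _ _ (sub_mem (D2_mem_weightSpace hp) hq), ?_⟩
      rw [Derivation.map_smul, map_sub, e, sub_sub_cancel, smul_smul, inv_mul_cancel₀ hc, one_smul]
  refine step (w + 1) p hp (by_contra fun h => ?_)
  obtain ⟨k, -, e⟩ := exists_nat_of_mem_weightSpace (D1_iterate_mem_weightSpace hp _) h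
  have : ((k + 1 : ℕ) : ℂ) = ((0 : ℕ) : ℂ) := by
    push_cast at e ⊢; linear_combination -e
  have := Nat.cast_injective this
  omega

/-! ### The dimension of the space of seminvariants -/

theorem coeff_aeval_weightD (P : Polynomial ℂ) (a : Fin (d + 1) →₀ ℕ)
    (p : MvPolynomial (Fin (d + 1)) ℂ) :
    coeff a (Polynomial.aeval (weightD d : Module.End ℂ (MvPolynomial (Fin (d + 1)) ℂ)) P p) =
      P.eval (wt a : ℂ) * coeff a p := by
  induction P using Polynomial.induction_on' with
  | add P Q hP hQ =>
    rw [map_add, LinearMap.add_apply, coeff_add, hP, hQ, Polynomial.eval_add, add_mul]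
  | monomial k c =>
    rw [Polynomial.aeval_monomial, Polynomial.eval_monomial, Module.algebraMap_end_eq_smul_id,
      Module.End.mul_apply, LinearMap.smul_apply, LinearMap.id_apply, coeff_smul,
      smul_eq_mul, mul_assoc]
    congr 1
    induction k with
    | zero => simp
    | succ k ih =>
      rw [pow_succ', Module.End.mul_apply, Derivation.coeFn_coe, coeff_weightD, ih]; ring

theorem D1_aeval_weightD (P : Polynomial ℂ) {p : MvPolynomial (Fin (d + 1)) ℂ}
    (hp : D1 d p = 0) :
    D1 d (Polynomial.aeval (weightD d : Module.End ℂ (MvPolynomial (Fin (d + 1)) ℂ)) P p) = 0 := by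
  induction P using Polynomial.induction_on' with
  | add P Q hP hQ => rw [map_add, LinearMap.add_apply, map_add, hP, hQ, add_zero]
  | monomial k c =>
    rw [Polynomial.aeval_monomial, Module.algebraMap_end_eq_smul_id, Module.End.mul_apply,
      LinearMap.smul_apply, LinearMap.id_apply, Derivation.map_smul]
    refine smul_eq_zero_of_right _ ?_
    induction k with
    | zero => simpa using hp
    | succ k ih =>
      have := weightD_D1 (d := d)
        (((weightD d : Module.End ℂ (MvPolynomial (Fin (d + 1)) ℂ)) ^ k) p)
      rw [ih, map_zero, sub_zero] at this
      rw [pow_succ', Module.End.mul_apply, Derivation.coeFn_coe, ← this]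

theorem mem_Sn {n : ℕ} {p : MvPolynomial (Fin (d + 1)) ℂ} :
    p ∈ Sn d n ↔ (∀ a, coeff a p ≠ 0 → ∑ i, a i = n) ∧ D1 d p = 0 := by
  rw [Sn, Submodule.mem_inf, mem_homogeneousSubmodule, LinearMap.mem_ker]
  refine and_congr ⟨fun h a ha => ?_, fun h a ha => ?_⟩ Iff.rfl
  · rw [← h ha, Finsupp.weight_apply, Finsupp.sum_fintype _ _ (by simp)]; simp
  · rw [← h a ha, Finsupp.weight_apply, Finsupp.sum_fintype _ _ (by simp)]; simp

/-- A seminvariant of degree `n` has no terms of weight above `d * n / 2`. -/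
theorem two_mul_wt_le_of_mem_Sn {n : ℕ} {p : MvPolynomial (Fin (d + 1)) ℂ} (hp : p ∈ Sn d n)
    {a : Fin (d + 1) →₀ ℕ} (ha : coeff a p ≠ 0) : 2 * wt a ≤ d * n := by
  by_contra! hlt
  obtain ⟨hdeg, hker⟩ := mem_Sn.mp hp
  let P : Polynomial ℂ :=
    ∏ w ∈ (Finset.range (d * n + 1)).erase (wt a), (Polynomial.X - Polynomial.C (w : ℂ))
  have hP (m : ℕ) :
      P.eval (m : ℂ) = ∏ w ∈ (Finset.range (d * n + 1)).erase (wt a), ((m : ℂ) - w) := by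
    simp [P, Polynomial.eval_prod]
  set q := Polynomial.aeval (weightD d : Module.End ℂ (MvPolynomial (Fin (d + 1)) ℂ)) P p with hq
  have hmem : q ∈ weightSpace d n (wt a) := by
    constructor <;> ext b
    · rw [coeff_eulerD, coeff_smul, hq, coeff_aeval_weightD, smul_eq_mul]
      by_cases hb : coeff b p = 0
      · simp [hb]
      · rw [hdeg b hb]
    · rw [coeff_weightD, coeff_smul, hq, coeff_aeval_weightD, smul_eq_mul]
      by_cases hb : coeff b p = 0
      · simp [hb]
      by_cases hw : wt b = wt a
      · rw [hw]
      · have h0 : P.eval (wt b : ℂ) = 0 := by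
          rw [hP]
          refine Finset.prod_eq_zero (i := wt b) ?_ (sub_self _)
          have := wt_le b
          rw [hdeg b hb] at this
          exact Finset.mem_erase.mpr ⟨hw, Finset.mem_range.mpr (by omega)⟩
        rw [h0]; simp
  have h := congrArg (coeff a) (eq_zero_of_D1_eq_zero hlt hmem (D1_aeval_weightD P hker))
  rw [coeff_aeval_weightD, coeff_zero, hP] at h
  refine (mul_ne_zero (Finset.prod_ne_zero_iff.mpr fun w hw => ?_) ha) h
  exact sub_ne_zero.mpr fun e => (Finset.mem_erase.mp hw).1 (Nat.cast_injective e).symm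

theorem finrank_restrictSupport_coe {σ : Type*} (s : Finset (σ →₀ ℕ)) :
    Module.finrank ℂ (restrictSupport ℂ (s : Set (σ →₀ ℕ))) = s.card := by
  rw [Module.finrank_eq_nat_card_basis (basisRestrictSupport ℂ _)]
  simp

/-- For `d * n = 2 * m`, the seminvariants of degree `n` are counted by the monomials of degree `n`
and weight `m`. -/
theorem finrank_Sn {n m : ℕ} (hm : d * n = 2 * m) :
    Module.finrank ℂ (Sn d n) =
      (((Finset.univ : Finset (Fin (d + 1))).finsuppAntidiag n).filter fun a => wt a = m).card := by
  set A := (Finset.univ : Finset (Fin (d + 1))).finsuppAntidiag n with hA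
  have memA (a) : a ∈ A ↔ ∑ i, a i = n := by simp [hA]
  set U := restrictSupport ℂ (A.filter fun a => wt a ≤ m : Set (Fin (d + 1) →₀ ℕ)) with hU
  set U' := restrictSupport ℂ (A.filter fun a => wt a < m : Set (Fin (d + 1) →₀ ℕ)) with hU'
  have memU (p) : p ∈ U ↔ ∀ a, coeff a p ≠ 0 → ∑ i, a i = n ∧ wt a ≤ m := by
    simp [hU, mem_restrictSupport_iff, Set.subset_def, memA]
  have memU' (p) : p ∈ U' ↔ ∀ a, coeff a p ≠ 0 → ∑ i, a i = n ∧ wt a < m := by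
    simp [hU', mem_restrictSupport_iff, Set.subset_def, memA]
  have maps : ∀ p ∈ U, (D1 d).toLinearMap p ∈ U' := by
    suffices h : U ≤ U'.comap (D1 d).toLinearMap from h
    rw [hU, restrictSupport_eq_span, Submodule.span_le]
    rintro _ ⟨a, ha, rfl⟩
    obtain ⟨h1, h2⟩ := Finset.mem_filter.mp (Finset.mem_coe.mp ha)
    refine (memU' _).mpr fun b hb => ?_
    obtain ⟨e1, e2⟩ :=
      eq_of_mem_weightSpace (D1_mem_weightSpace (monomial_mem_weightSpace a 1)) hb
    have e3 : wt b + 1 = wt a := by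
      have : ((wt b + 1 : ℕ) : ℂ) = (wt a : ℂ) := by push_cast; linear_combination e2
      exact Nat.cast_injective this
    exact ⟨(Nat.cast_injective e1).trans ((memA a).mp h1), by omega⟩
  let g := (D1 d).toLinearMap.restrict maps
  have surj : LinearMap.range g = ⊤ := by
    suffices h : U' ≤ U.map (D1 d).toLinearMap by
      refine LinearMap.range_eq_top.mpr fun ⟨y, hy⟩ => ?_
      obtain ⟨x, hx, rfl⟩ := h hy
      exact ⟨⟨x, hx⟩, rfl⟩
    rw [hU', restrictSupport_eq_span, Submodule.span_le]
    rintro _ ⟨a, ha, rfl⟩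
    obtain ⟨h1, h2⟩ := Finset.mem_filter.mp (Finset.mem_coe.mp ha)
    have hmon := monomial_mem_weightSpace a 1
    rw [(memA a).mp h1] at hmon
    obtain ⟨q, hq, e⟩ := exists_D1_eq (by omega) hmon
    refine ⟨q, (memU q).mpr fun b hb => ?_, e⟩
    obtain ⟨e1, e2⟩ := eq_of_mem_weightSpace hq hb
    have e3 : wt b = wt a + 1 := Nat.cast_injective (R := ℂ) (by rw [e2]; push_cast; rfl)
    exact ⟨Nat.cast_injective e1, by omega⟩
  have le : Sn d n ≤ U := fun p hp => (memU p).mpr fun a ha =>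
    ⟨(mem_Sn.mp hp).1 a ha, by have := two_mul_wt_le_of_mem_Sn hp ha; omega⟩
  have ker : LinearMap.ker g = (Sn d n).comap U.subtype := by
    ext ⟨p, hp⟩
    rw [LinearMap.mem_ker, Submodule.mem_comap, Submodule.subtype_apply, mem_Sn,
      and_iff_right fun a ha => ((memU p).mp hp a ha).1]
    exact Subtype.ext_iff
  have : Module.Finite ℂ U := Module.Finite.of_basis (basisRestrictSupport ℂ _)
  have rn := LinearMap.finrank_range_add_finrank_ker g
  rw [surj, finrank_top, ker, (Submodule.comapSubtypeEquivOfLe le).finrank_eq, hU, hU',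
    finrank_restrictSupport_coe, finrank_restrictSupport_coe] at rn
  have hsum : (A.filter fun a => wt a ≤ m).card =
      (A.filter fun a => wt a < m).card + (A.filter fun a => wt a = m).card := by
    rw [← Finset.card_union_of_disjoint, ← Finset.filter_or]
    · simp only [le_iff_lt_or_eq]
    · exact Finset.disjoint_filter.mpr fun a _ h h' => h.ne h'
  omega

theorem PSeries_ten :
    PSeries 10 = PowerSeries.mk fun n =>
      PowerSeries.coeff (5 * n) (PowerSeries.coeff n (bigraded 10)) := by
  ext n
  rw [PSeries, PowerSeries.coeff_mk, PowerSeries.coeff_mk, coeff_bigraded,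
    finrank_Sn (m := 5 * n) (by ring)]
  rfl

end BinaryForm

/-- The Poincaré series of the algebra of covariants of the binary 10-form. -/
theorem poincare_series_d10 :
    PSeries 10 = (1 + 3 * (PowerSeries.X : PowerSeries ℂ) ^ 2 + 11 * (PowerSeries.X : PowerSeries ℂ) ^ 3 + 27 * (PowerSeries.X : PowerSeries ℂ) ^ 4 + 58 * (PowerSeries.X : PowerSeries ℂ) ^ 5 + 112 * (PowerSeries.X : PowerSeries ℂ) ^ 6 + 193 * (PowerSeries.X : PowerSeries ℂ) ^ 7 + 318 * (PowerSeries.X : PowerSeries ℂ) ^ 8 + 485 * (PowerSeries.X : PowerSeries ℂ) ^ 9 + 699 * (PowerSeries.X : PowerSeries ℂ) ^ 10 + 951 * (PowerSeries.X : PowerSeries ℂ) ^ 11 + 1245 * (PowerSeries.X : PowerSeries ℂ) ^ 12 + 1541 * (PowerSeries.X : PowerSeries ℂ) ^ 13 + 1842 * (PowerSeries.X : PowerSeries ℂ) ^ 14 + 2108 * (PowerSeries.X : PowerSeries ℂ) ^ 15 + 2321 * (PowerSeries.X : PowerSeries ℂ) ^ 16 + 2451 * (PowerSeries.X : PowerSeries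 ℂ) ^ 17 + 2506 * (PowerSeries.X : PowerSeries ℂ) ^ 18 + 2451 * (PowerSeries.X : PowerSeries ℂ) ^ 19 + 2321 * (PowerSeries.X : PowerSeries ℂ) ^ 20 + 2108 * (PowerSeries.X : PowerSeries ℂ) ^ 21 + 1842 * (PowerSeries.X : PowerSeries ℂ) ^ 22 + 1541 * (PowerSeries.X : PowerSeries ℂ) ^ 23 + 1245 * (PowerSeries.X : PowerSeries ℂ) ^ 24 + 951 * (PowerSeries.X : PowerSeries ℂ) ^ 25 + 699 * (PowerSeries.X : PowerSeries ℂ) ^ 26 + 485 * (PowerSeries.X : PowerSeries ℂ) ^ 27 + 318 * (PowerSeries.X : PowerSeries ℂ) ^ 28 + 193 * (PowerSeries.X : PowerSeries ℂ) ^ 29 + 112 * (PowerSeries.X : PowerSeries ℂ) ^ 30 + 58 * (PowerSeries.X : PowerSeries ℂ) ^ 31 + 27 * (PowerSeries.X : PowerSeries ℂ) ^ 32 + 11 * (PowerSeries.X : PowerSeries ℂ) ^ 33 + 3 * (PowerSeries.X : PowerSeries ℂ) ^ 34 + (PowerSeries.X : PowerSeries ℂ) ^ 36) * ((1 - (PowerSeries.X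 : PowerSeries ℂ)) * (1 - (PowerSeries.X : PowerSeries ℂ) ^ 2) ^ 2 * (1 - (PowerSeries.X : PowerSeries ℂ) ^ 3) * (1 - (PowerSeries.X : PowerSeries ℂ) ^ 4) * (1 - (PowerSeries.X : PowerSeries ℂ) ^ 5) * (1 - (PowerSeries.X : PowerSeries ℂ) ^ 6) * (1 - (PowerSeries.X : PowerSeries ℂ) ^ 7) * (1 - (PowerSeries.X : PowerSeries ℂ) ^ 8) * (1 - (PowerSeries.X : PowerSeries ℂ) ^ 9))⁻¹ := by
  have hc : PowerSeries.constantCoeff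
      (BinaryForm.prodOneSub [1, 2, 2, 3, 4, 5, 6, 7, 8, 9]) ≠ 0 := by
    rw [BinaryForm.constantCoeff_prodOneSub (by simp)]
    exact one_ne_zero
  rw [BinaryForm.PSeries_ten, ← BinaryForm.ofList_decicNumer, ← BinaryForm.prodOneSub_decicDenom,
    PowerSeries.eq_mul_inv_iff_mul_eq hc, mul_comm]
  exact BinaryForm.prodOneSub_mul_mk_coeff_bigraded

end
end
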